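/- Let d = (d,d,…,d) be a regular degree sequence satisfying the conditions of the main theorem (in particular min{d, n−d−1} ≥ n/(3a log n) with a+b < 1/2). If n is even, then the expected number of perfect matchings in a uniformly random d-regular graph on n vertices is (λ^{n/2} · n!)/(2^{n/2} (n/2)!) · exp( (1−λ)/(4λ) + O(n^{−b}) ) as n → ∞, where λ = d/(n−1). -/

import Mathlib

open Filter Finset Asymptotics MeasureTheory
open scoped Classical Topology

noncomputable section

/-- The number of simple graphs on `Fin n` with degree sequence `d` having
no edge in common with the graph `X`. -/
def gCount {n : ℕ} (d : Fin n → ℕ) (X : SimpleGraph (Fin n)) : ℕ :=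
  Nat.card {H : SimpleGraph (Fin n) //
    (∀ v, Nat.card (H.neighborSet v) = d v) ∧ Disjoint H.edgeSet X.edgeSet}

/-- The degree `x_j` of vertex `j` in the graph `X`. -/
def xDeg {n : ℕ} (X : SimpleGraph (Fin n)) (j : Fin n) : ℕ :=
  Nat.card (X.neighborSet j)

/-- The number of edges of `X`. -/
def xEdges {n : ℕ} (X : SimpleGraph (Fin n)) : ℕ := Nat.card X.edgeSet

/-- The average degree `d̄ = 2E/n`. -/
def dBar {n : ℕ} (d : Fin n → ℕ) : ℝ := (∑ j, (d j : ℝ)) / n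

/-- The density `λ = d̄/(n-1)`. -/
def lamb {n : ℕ} (d : Fin n → ℕ) : ℝ := dBar d / ((n : ℝ) - 1)

/-- `A = λ(1-λ)/2`. -/
def aPar {n : ℕ} (d : Fin n → ℕ) : ℝ := lamb d * (1 - lamb d) / 2

/-- `δ_j = d_j - d̄ + λ x_j`. -/
def deltaPar {n : ℕ} (d : Fin n → ℕ) (X : SimpleGraph (Fin n)) (j : Fin n) : ℝ :=
  (d j : ℝ) - dBar d + lamb d * (xDeg X j : ℝ)

/-- The sum over unordered pairs `{j,k}` with `X.Adj j k` of `f j * f k`. -/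
def pairSum {n : ℕ} (X : SimpleGraph (Fin n)) (f : Fin n → ℝ) : ℝ :=
  (∑ j, ∑ k, if X.Adj j k then f j * f k else 0) / 2

/-- `R = Σ_j (d_j - d̄)²`. -/
def rPar {n : ℕ} (d : Fin n → ℕ) : ℝ := ∑ j, ((d j : ℝ) - dBar d)^2

/-- The naive estimate `Ĝ(d,X)`. -/
def gHat {n : ℕ} (d : Fin n → ℕ) (X : SimpleGraph (Fin n)) : ℝ :=
  (1 - lamb d) ^ (-(xEdges X : ℝ)) *
  (lamb d ^ lamb d * (1 - lamb d) ^ (1 - lamb d)) ^ n.choose 2 *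
  ∏ j, ((n - 1 - xDeg X j).choose (d j) : ℝ)

/-- `λ = d/(n-1)` for a `d`-regular sequence. -/
def lamR (n D : ℕ) : ℝ := (D : ℝ) / ((n : ℝ) - 1)

/-- The number of `D`-regular simple graphs on `Fin n`. -/
def regCount (n D : ℕ) : ℕ :=
  gCount (fun _ : Fin n => D) (⊥ : SimpleGraph (Fin n))

/-- The number of pairs `(H, M)` where `H` is a `D`-regular graph on `Fin n`
and `M` is a perfect matching of `H`; dividing by the number of `D`-regular
graphs gives the expected number of perfect matchings. -/
def pmPairs (n D : ℕ) : ℕ :=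
  Nat.card {p : Σ H : SimpleGraph (Fin n), H.Subgraph //
    (∀ v, Nat.card (p.1.neighborSet v) = D) ∧ p.2.IsPerfectMatching}

set_option linter.unusedSectionVars false

section Basics

variable {V : Type*}

/-- The adjacency indicator of a graph, with real values. -/
def ind (G : SimpleGraph V) (u v : V) : ℝ := if G.Adj u v then 1 else 0

lemma ind_comm (G : SimpleGraph V) (u v : V) : ind G u v = ind G v u := by
  simp [ind, G.adj_comm]

@[simp] lemma ind_self (G : SimpleGraph V) (u : V) : ind G u u = 0 := by simp [ind]

lemma ind_eq_one_iff {G : SimpleGraph V} {u v : V} : ind G u v = 1 ↔ G.Adj u v := by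
  simp [ind]

lemma ind_eq_zero_iff {G : SimpleGraph V} {u v : V} : ind G u v = 0 ↔ ¬ G.Adj u v := by
  simp [ind]

lemma ind_zero_or_one (G : SimpleGraph V) (u v : V) : ind G u v = 0 ∨ ind G u v = 1 := by
  unfold ind; split_ifs <;> simp

lemma ind_nonneg (G : SimpleGraph V) (u v : V) : 0 ≤ ind G u v := by
  unfold ind; split_ifs <;> simp

lemma ind_le_one (G : SimpleGraph V) (u v : V) : ind G u v ≤ 1 := by
  unfold ind; split_ifs <;> simp

lemma ind_mul_self (G : SimpleGraph V) (u v : V) : ind G u v * ind G u v = ind G u v := by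
  unfold ind; split_ifs <;> simp

/-- Flip the adjacency of `a` and `b`. -/
def toggle (a b : V) (G : SimpleGraph V) : SimpleGraph V := symmDiff G (SimpleGraph.edge a b)

lemma toggle_toggle (a b : V) (G : SimpleGraph V) : toggle a b (toggle a b G) = G :=
  symmDiff_symmDiff_cancel_right _ _

lemma toggle_comm (a b c d : V) (G : SimpleGraph V) :
    toggle a b (toggle c d G) = toggle c d (toggle a b G) := by
  simp only [toggle, symmDiff_assoc, symmDiff_comm (SimpleGraph.edge c d)]

variable [DecidableEq V]

lemma ind_edge {a b : V} (h : a ≠ b) (u v : V) :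
    ind (SimpleGraph.edge a b) u v = if (u = a ∧ v = b) ∨ (u = b ∧ v = a) then 1 else 0 := by
  unfold ind
  rw [SimpleGraph.edge_adj]
  congr 1
  grind

lemma ind_toggle {a b : V} (h : a ≠ b) (G : SimpleGraph V) (u v : V) :
    ind (toggle a b G) u v =
      ind G u v + (1 - 2 * ind G a b) * ind (SimpleGraph.edge a b) u v := by
  rw [ind_edge h]
  have key : (toggle a b G).Adj u v ↔
      (G.Adj u v ∧ ¬(SimpleGraph.edge a b).Adj u v) ∨
        ((SimpleGraph.edge a b).Adj u v ∧ ¬ G.Adj u v) := by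
    simp [toggle, symmDiff]
  rw [SimpleGraph.edge_adj] at key
  have hs := G.adj_comm a b
  unfold ind
  by_cases h1 : (u = a ∧ v = b) ∨ (u = b ∧ v = a)
  · rw [if_pos h1]
    have : G.Adj u v ↔ G.Adj a b := by rcases h1 with ⟨rfl, rfl⟩ | ⟨rfl, rfl⟩ <;> tauto
    by_cases h2 : G.Adj a b
    · rw [if_neg, if_pos (this.2 h2), if_pos h2]
      · norm_num
      · grind
    · rw [if_pos, if_neg (mt this.1 h2), if_neg h2]
      · norm_num
      · grind
  · rw [if_neg h1]
    have : (toggle a b G).Adj u v ↔ G.Adj u v := by grind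
    simp [this]

variable [Fintype V]

lemma sum_ind_edge {a b : V} (h : a ≠ b) (u : V) :
    ∑ v, ind (SimpleGraph.edge a b) u v = (if u = a then 1 else 0) + if u = b then 1 else 0 := by
  have : ∀ v, ind (SimpleGraph.edge a b) u v =
      (if v = b then (if u = a then 1 else 0) else 0) +
        (if v = a then (if u = b then 1 else 0) else 0) := by
    intro v
    rw [ind_edge h]
    grind
  simp [this, sum_add_distrib]

lemma sum_ind_toggle {a b : V} (h : a ≠ b) (G : SimpleGraph V) (u : V) :
    ∑ v, ind (toggle a b G) u v = ∑ v, ind G u v +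
      (1 - 2 * ind G a b) * ((if u = a then 1 else 0) + if u = b then 1 else 0) := by
  simp only [ind_toggle h, sum_add_distrib, ← mul_sum, sum_ind_edge h]

omit [Fintype V] in
lemma ind_toggle_self {a b : V} (h : a ≠ b) (G : SimpleGraph V) :
    ind (toggle a b G) a b = 1 - ind G a b := by
  rw [ind_toggle h, ind_edge h]; simp; ring

omit [Fintype V] in
lemma ind_toggle_of_ne {a b u v : V} (h : a ≠ b) (G : SimpleGraph V)
    (h1 : ¬ (u = a ∧ v = b)) (h2 : ¬ (u = b ∧ v = a)) :
    ind (toggle a b G) u v = ind G u v := by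
  rw [ind_toggle h, ind_edge h]; simp [h1, h2]

end Basics

section Switching

variable {V : Type*} [Fintype V] [DecidableEq V]

/-- The graphs all of whose degrees are `d`, containing every edge `v — σ v`. -/
def regContaining (d : ℝ) (σ : Equiv.Perm V) : Finset (SimpleGraph V) :=
  univ.filter fun G => (∀ v, ∑ w, ind G v w = d) ∧ ∀ v, σ v ≠ v → G.Adj v (σ v)

/-- The indicator that `σ` matches `u` and `v`. -/
def mat (σ : Equiv.Perm V) (u v : V) : ℝ := if σ u = v ∧ u ≠ v then 1 else 0

/-- The indicator of adjacency in the complement. -/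
def coind (G : SimpleGraph V) (u v : V) : ℝ := 1 - (if u = v then 1 else 0) - ind G u v

/-- Replace the edges `ab`, `xy` by `ax`, `by`, or conversely. -/
def switch (a b x y : V) (G : SimpleGraph V) : SimpleGraph V :=
  toggle a b (toggle x y (toggle a x (toggle b y G)))

lemma switch_switch (a b x y : V) (G : SimpleGraph V) :
    switch a b x y (switch a b x y G) = G := by
  unfold switch
  rw [toggle_comm b y a b, toggle_comm a x a b, toggle_comm x y a b, toggle_toggle,
    toggle_comm b y x y, toggle_comm a x x y, toggle_toggle, toggle_comm b y a x,
    toggle_toggle, toggle_toggle]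

lemma switch_mem {d : ℝ} {σ : Equiv.Perm V} (hσ : ∀ v, σ (σ v) = v) {a b x y : V}
    (ha : σ a = a) (hb : σ b = b)
    (hab : a ≠ b) (hax : a ≠ x) (hay : a ≠ y) (hbx : b ≠ x) (hby : b ≠ y) (hxy : x ≠ y)
    (hxyσ : σ x ≠ y) {G : SimpleGraph V} (hG : G ∈ regContaining d σ)
    (h : ind G a b = ind G x y) (h' : ind G a x = ind G b y)
    (h'' : ind G a b = 1 - ind G a x) :
    switch a b x y G ∈ regContaining d σ := by
  simp only [regContaining, mem_filter, mem_univ, true_and] at hG ⊢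
  refine ⟨fun v => ?_, fun v hv => ?_⟩
  · unfold switch
    rw [sum_ind_toggle hab, sum_ind_toggle hxy, sum_ind_toggle hax, sum_ind_toggle hby, hG.1]
    rw [ind_toggle_of_ne hxy _ (by tauto) (by tauto), ind_toggle_of_ne hax _ (by tauto) (by tauto),
      ind_toggle_of_ne hby _ (by tauto) (by tauto), ind_toggle_of_ne hax _ (by tauto) (by tauto),
      ind_toggle_of_ne hby _ (by tauto) (by tauto), ind_toggle_of_ne hby _ (by tauto) (by tauto),
      ← h', ← h, h'']
    ring
  · rw [← ind_eq_one_iff]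
    unfold switch
    have hvv := hσ v
    rw [ind_toggle_of_ne hab _ (by grind) (by grind), ind_toggle_of_ne hxy _ (by grind) (by grind),
      ind_toggle_of_ne hax _ (by grind) (by grind), ind_toggle_of_ne hby _ (by grind) (by grind)]
    exact ind_eq_one_iff.2 (hG.2 v hv)

lemma switch_ind {a b x y : V}
    (hab : a ≠ b) (hax : a ≠ x) (hay : a ≠ y) (hbx : b ≠ x) (hby : b ≠ y) (hxy : x ≠ y)
    (G : SimpleGraph V) :
    ind (switch a b x y G) a b = 1 - ind G a b ∧ ind (switch a b x y G) x y = 1 - ind G x y ∧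
    ind (switch a b x y G) a x = 1 - ind G a x ∧ ind (switch a b x y G) b y = 1 - ind G b y := by
  unfold switch
  refine ⟨?_, ?_, ?_, ?_⟩
  · rw [ind_toggle_self hab, ind_toggle_of_ne hxy _ (by tauto) (by tauto),
      ind_toggle_of_ne hax _ (by tauto) (by tauto), ind_toggle_of_ne hby _ (by tauto) (by tauto)]
  · rw [ind_toggle_of_ne hab _ (by tauto) (by tauto), ind_toggle_self hxy,
      ind_toggle_of_ne hax _ (by tauto) (by tauto), ind_toggle_of_ne hby _ (by tauto) (by tauto)]
  · rw [ind_toggle_of_ne hab _ (by tauto) (by tauto), ind_toggle_of_ne hxy _ (by tauto) (by tauto),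
      ind_toggle_self hax, ind_toggle_of_ne hby _ (by tauto) (by tauto)]
  · rw [ind_toggle_of_ne hab _ (by tauto) (by tauto), ind_toggle_of_ne hxy _ (by tauto) (by tauto),
      ind_toggle_of_ne hax _ (by tauto) (by tauto), ind_toggle_self hby]

lemma sum_switch_of_distinct {d : ℝ} {σ : Equiv.Perm V} (hσ : ∀ v, σ (σ v) = v) {a b x y : V}
    (ha : σ a = a) (hb : σ b = b)
    (hab : a ≠ b) (hax : a ≠ x) (hay : a ≠ y) (hbx : b ≠ x) (hby : b ≠ y) (hxy : x ≠ y)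
    (hxyσ : σ x ≠ y) :
    ∑ G ∈ regContaining d σ, ind G a b * ind G x y * ((1 - ind G a x) * (1 - ind G b y)) =
    ∑ G ∈ regContaining d σ, ind G a x * ind G b y * ((1 - ind G a b) * (1 - ind G x y)) := by
  have e1 : ∀ G : SimpleGraph V,
      ind G a b * ind G x y * ((1 - ind G a x) * (1 - ind G b y)) =
      if (ind G a b = 1 ∧ ind G x y = 1 ∧ ind G a x = 0 ∧ ind G b y = 0) then 1 else 0 := by
    intro G
    rcases ind_zero_or_one G a b with h1 | h1 <;> rcases ind_zero_or_one G x y with h2 | h2 <;>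
    rcases ind_zero_or_one G a x with h3 | h3 <;> rcases ind_zero_or_one G b y with h4 | h4 <;>
    simp [h1, h2, h3, h4]
  have e2 : ∀ G : SimpleGraph V,
      ind G a x * ind G b y * ((1 - ind G a b) * (1 - ind G x y)) =
      if (ind G a b = 0 ∧ ind G x y = 0 ∧ ind G a x = 1 ∧ ind G b y = 1) then 1 else 0 := by
    intro G
    rcases ind_zero_or_one G a b with h1 | h1 <;> rcases ind_zero_or_one G x y with h2 | h2 <;>
    rcases ind_zero_or_one G a x with h3 | h3 <;> rcases ind_zero_or_one G b y with h4 | h4 <;>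
    simp [h1, h2, h3, h4]
  simp only [e1, e2, sum_boole]
  congr 1
  refine card_nbij' (switch a b x y) (switch a b x y) ?_ ?_
    (fun G _ => switch_switch a b x y G) (fun G _ => switch_switch a b x y G)
  · intro G hG
    simp only [coe_filter, Set.mem_ofPred_eq] at hG ⊢
    obtain ⟨hG, h1, h2, h3, h4⟩ := hG
    obtain ⟨g1, g2, g3, g4⟩ := switch_ind hab hax hay hbx hby hxy G
    refine ⟨switch_mem hσ ha hb hab hax hay hbx hby hxy hxyσ hG (by rw [h1, h2]) (by rw [h3, h4])
      (by rw [h1, h3]; ring), ?_⟩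
    rw [g1, g2, g3, g4, h1, h2, h3, h4]
    norm_num
  · intro G hG
    simp only [coe_filter, Set.mem_ofPred_eq] at hG ⊢
    obtain ⟨hG, h1, h2, h3, h4⟩ := hG
    obtain ⟨g1, g2, g3, g4⟩ := switch_ind hab hax hay hbx hby hxy G
    refine ⟨switch_mem hσ ha hb hab hax hay hbx hby hxy hxyσ hG (by rw [h1, h2]) (by rw [h3, h4])
      (by rw [h1, h3]; ring), ?_⟩
    rw [g1, g2, g3, g4, h1, h2, h3, h4]
    norm_num

lemma sum_switch {d : ℝ} {σ : Equiv.Perm V} (hσ : ∀ v, σ (σ v) = v) {a b : V}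
    (ha : σ a = a) (hb : σ b = b) (x y : V) :
    ∑ G ∈ regContaining d σ, ind G a b * (ind G x y - mat σ x y) * (coind G a x * coind G b y) =
    ∑ G ∈ regContaining d σ, ind G a x * ind G b y * (coind G a b * coind G x y) := by
  by_cases hab : a = b
  · subst hab; simp [coind]
  by_cases hax : a = x
  · subst hax; simp [coind]
  by_cases hby : b = y
  · subst hby; simp [coind]
  by_cases hxy : x = y
  · subst hxy; simp [coind, mat]
  by_cases hay : a = y
  · subst hay
    refine sum_congr rfl fun G _ => ?_
    have : mat σ x a = 0 := by simp only [mat]; grind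
    rw [this]
    simp only [coind, ind_comm G x a, ind_comm G b a, hab, Ne.symm hab, hax, Ne.symm hax, if_false]
    linear_combination (- (1 - ind G a b) * ind G a b) * ind_mul_self G a x
      + (ind G a x * (1 - ind G a x)) * ind_mul_self G a b
  by_cases hbx : b = x
  · subst hbx
    refine sum_congr rfl fun G _ => ?_
    have : mat σ b y = 0 := by simp only [mat]; grind
    rw [this]
    simp only [coind, hab, hby, if_false]
    linear_combination (- (1 - ind G a b) * ind G a b) * ind_mul_self G b y
      + (ind G b y * (1 - ind G b y)) * ind_mul_self G a b
  by_cases hs : σ x = y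
  · refine sum_congr rfl fun G hG => ?_
    have h1 : ind G x y = 1 := by
      subst hs
      exact ind_eq_one_iff.2 ((mem_filter.1 hG).2.2 x (Ne.symm hxy))
    simp [coind, mat, hs, hxy, h1]
  · have : mat σ x y = 0 := by simp [mat, hs]
    have := sum_switch_of_distinct (d := d) hσ ha hb hab hax hay hbx hby hxy hs
    simpa [coind, hab, hax, hby, hxy, mat, hs] using this

end Switching

section Identity

variable {V : Type*} [Fintype V] [DecidableEq V]

/-- The bilinear form of the adjacency matrix. -/
def bil (G : SimpleGraph V) (f g : V → ℝ) : ℝ := ∑ u, ∑ v, f u * ind G u v * g v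

/-- The adjacency vector of `x`, restricted to `U`. -/
def nbrVec (G : SimpleGraph V) (U : Finset V) (x u : V) : ℝ := if u ∈ U then ind G u x else 0

/-- The number of neighbours of `x` in `U`. -/
def degIn (G : SimpleGraph V) (U : Finset V) (x : V) : ℝ := ∑ u ∈ U, ind G u x

/-- The fixed points of `σ`. -/
def fixedPts (σ : Equiv.Perm V) : Finset V := univ.filter fun v => σ v = v

/-- Twice the number of edges inside `U`. -/
def edgesIn (G : SimpleGraph V) (U : Finset V) : ℝ := ∑ u ∈ U, ∑ v ∈ U, ind G u v

lemma sum_mul_coind (G : SimpleGraph V) (M : V → V → ℝ) (u v : V) :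
    ∑ x, ∑ y, M x y * (coind G u x * coind G v y) =
      ∑ x, ∑ y, M x y - ∑ x, M x v - ∑ x, ∑ y, M x y * ind G v y
      - (∑ y, M u y - M u v - ∑ y, M u y * ind G v y)
      - (∑ x, ∑ y, ind G u x * M x y - ∑ x, ind G u x * M x v
          - ∑ x, ∑ y, M x y * (ind G u x * ind G v y)) := by
  have : ∀ x y, M x y * (coind G u x * coind G v y) =
      M x y - (if v = y then M x y else 0) - M x y * ind G v y
      - ((if u = x then M x y else 0) - (if u = x then (if v = y then M x y else 0) else 0)
          - (if u = x then M x y * ind G v y else 0))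
      - (ind G u x * M x y - (if v = y then ind G u x * M x y else 0)
          - M x y * (ind G u x * ind G v y)) := by
    intro x y
    unfold coind
    split_ifs <;> ring
  simp only [this, sum_sub_distrib, sum_ite_eq, mem_univ, if_true]
  congr 2
  simp

lemma sum_coind_mul (G : SimpleGraph V) (f g : V → ℝ) :
    ∑ x, ∑ y, f x * g y * coind G x y =
      (∑ x, f x) * (∑ y, g y) - ∑ x, f x * g x - bil G f g := by
  have : ∀ x y, f x * g y * coind G x y =
      f x * g y - (if x = y then f x * g y else 0) - f x * ind G x y * g y := by
    intro x y
    unfold coind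
    split_ifs <;> ring
  simp only [this, sum_sub_distrib, sum_ite_eq, mem_univ, if_true, bil, sum_mul_sum]

lemma sum_coind_mul_subset (G : SimpleGraph V) (U : Finset V) (f : V → V → ℝ) :
    ∑ u ∈ U, ∑ v ∈ U, coind G u v * f u v =
      ∑ u ∈ U, ∑ v ∈ U, f u v - ∑ u ∈ U, f u u - ∑ u ∈ U, ∑ v ∈ U, ind G u v * f u v := by
  have : ∀ u v, coind G u v * f u v =
      f u v - (if u = v then f u v else 0) - ind G u v * f u v := by
    intro x y
    unfold coind
    split_ifs <;> ring
  simp only [this, sum_sub_distrib, sum_ite_eq]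
  congr 2
  exact sum_congr rfl fun x hx => by simp [hx]

lemma sum_nbrVec (G : SimpleGraph V) (U : Finset V) (x : V) :
    ∑ u, nbrVec G U x u = degIn G U x := by
  simp [nbrVec, degIn, sum_ite_mem]

lemma bil_nbrVec (G : SimpleGraph V) (U : Finset V) (x y : V) :
    bil G (nbrVec G U x) (nbrVec G U y) =
      ∑ u ∈ U, ∑ v ∈ U, ind G u v * (ind G u x * ind G v y) := by
  have : ∀ u v, nbrVec G U x u * ind G u v * nbrVec G U y v =
      if u ∈ U then (if v ∈ U then ind G u v * (ind G u x * ind G v y) else 0) else 0 := by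
    intro u v
    unfold nbrVec
    split_ifs <;> ring
  unfold bil
  simp only [this]
  have h : ∀ u (g : V → ℝ), ∑ v, (if u ∈ U then g v else 0) = if u ∈ U then ∑ v, g v else 0 := by
    intro u g
    split_ifs <;> simp
  simp only [h, sum_ite_mem, univ_inter]

/-- The number of common neighbours. -/
def codeg (G : SimpleGraph V) (u v : V) : ℝ := ∑ y, ind G u y * ind G v y

/-- The indicator of the support of `σ`. -/
def moved (σ : Equiv.Perm V) (x : V) : ℝ := if σ x = x then 0 else 1

lemma mat_comm {σ : Equiv.Perm V} (hσ : ∀ v, σ (σ v) = v) (x y : V) : mat σ x y = mat σ y x := by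
  unfold mat
  have h1 := hσ x
  have h2 := hσ y
  congr 1
  grind

lemma sum_mat (σ : Equiv.Perm V) (f : V → ℝ) (x : V) :
    ∑ y, mat σ x y * f y = moved σ x * f (σ x) := by
  have : ∀ y, mat σ x y * f y = if σ x = y then moved σ x * f (σ x) else 0 := by
    intro y
    unfold mat moved
    split_ifs <;> grind
  simp [this]

lemma sum_moved (σ : Equiv.Perm V) :
    ∑ x, moved σ x = (Fintype.card V : ℝ) - #(fixedPts σ) := by
  have : ∀ x, moved σ x = 1 - if σ x = x then 1 else 0 := by
    intro x; unfold moved; split_ifs <;> ring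
  simp [this, fixedPts]

lemma sum_ind_mul_moved {G : SimpleGraph V} {d : ℝ} (hd : ∀ v, ∑ w, ind G v w = d)
    (σ : Equiv.Perm V) (u : V) :
    ∑ y, ind G u y * moved σ y = d - degIn G (fixedPts σ) u := by
  have : ∀ y, ind G u y * moved σ y = ind G u y - if σ y = y then ind G y u else 0 := by
    intro y; unfold moved; rw [ind_comm G y u]; split_ifs <;> ring
  simp only [this, sum_sub_distrib, hd, degIn, fixedPts, sum_filter]

lemma sum_sub_mat_mul_coind {G : SimpleGraph V} {d : ℝ} (hd : ∀ v, ∑ w, ind G v w = d)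
    {σ : Equiv.Perm V} (hσ : ∀ v, σ (σ v) = v) {u v : V} (hu : σ u = u) (hv : σ v = v) :
    ∑ x, ∑ y, (ind G x y - mat σ x y) * (coind G u x * coind G v y) =
      Fintype.card V * d - (Fintype.card V - #(fixedPts σ)) - 2 * d ^ 2
        - degIn G (fixedPts σ) u - degIn G (fixedPts σ) v + ind G u v + 2 * codeg G u v
        + ∑ x, ∑ y, (ind G x y - mat σ x y) * (ind G u x * ind G v y) := by
  have m0 : ∀ w y, σ w = w → mat σ w y = 0 := by
    intro w y hw; unfold mat; grind
  have m1 : ∀ x, ∑ y, (ind G x y - mat σ x y) = d - moved σ x := by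
    intro x
    have := sum_mat σ (fun _ => 1) x
    simp only [mul_one] at this
    rw [sum_sub_distrib, hd, this]
  have m2 : ∀ x w, σ w = w → ind G x w - mat σ x w = ind G w x := by
    intro x w hw; rw [mat_comm hσ, m0 _ _ hw, ind_comm]; ring
  have m3 : ∀ y w, σ w = w → ind G w y - mat σ w y = ind G w y := by
    intro x w hw; rw [m0 _ _ hw]; ring
  have e1 : ∑ x, ∑ y, (ind G x y - mat σ x y) =
      Fintype.card V * d - (Fintype.card V - #(fixedPts σ)) := by
    simp only [m1, sum_sub_distrib, sum_moved]; simp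
  have e2 : ∑ x, ∑ y, (ind G x y - mat σ x y) * ind G v y =
      d ^ 2 - (d - degIn G (fixedPts σ) v) := by
    rw [sum_comm, ← sum_ind_mul_moved hd σ v]
    have : ∀ y, ∑ x, (ind G x y - mat σ x y) * ind G v y =
        ind G v y * d - ind G v y * moved σ y := by
      intro y
      rw [← sum_mul]
      simp only [ind_comm G _ y, mat_comm hσ _ y, m1]
      ring
    simp only [this, sum_sub_distrib, ← sum_mul, hd]
    ring
  have e3 : ∑ x, ∑ y, ind G u x * (ind G x y - mat σ x y) =
      d ^ 2 - (d - degIn G (fixedPts σ) u) := by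
    rw [← sum_ind_mul_moved hd σ u]
    simp only [← mul_sum, m1]
    simp only [mul_sub, sum_sub_distrib, ← sum_mul, hd]
    ring
  rw [sum_mul_coind, e1, e2, e3]
  simp only [m2 _ v hv, m3 _ u hu, hd, codeg]
  rw [ind_comm G v u]
  ring

lemma sum_codeg_mul (G : SimpleGraph V) (U : Finset V) (f : V → V → ℝ) :
    ∑ u ∈ U, ∑ v ∈ U, f u v * codeg G u v =
      ∑ y, ∑ u ∈ U, ∑ v ∈ U, f u v * (ind G u y * ind G v y) := by
  unfold codeg
  simp only [mul_sum]
  rw [sum_comm]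
  refine Eq.trans ?_ (sum_comm)
  rw [sum_comm]
  exact sum_congr rfl fun u _ => sum_comm

lemma sum_codeg (G : SimpleGraph V) (U : Finset V) :
    ∑ u ∈ U, ∑ v ∈ U, codeg G u v = ∑ y, degIn G U y ^ 2 := by
  have := sum_codeg_mul G U (fun _ _ => 1)
  simp only [one_mul] at this
  rw [this]
  exact sum_congr rfl fun y _ => by rw [sq, degIn, sum_mul_sum]

lemma sum_bil_ind (G : SimpleGraph V) (U : Finset V) :
    ∑ u ∈ U, ∑ v ∈ U, bil G (ind G u) (ind G v) = bil G (degIn G U) (degIn G U) := by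
  unfold bil degIn
  have : ∀ x y, (∑ u ∈ U, ind G u x) * ind G x y * (∑ u ∈ U, ind G u y) =
      ∑ u ∈ U, ∑ v ∈ U, ind G u x * ind G x y * ind G v y := by
    intro x y
    rw [sum_mul, sum_mul_sum]
  simp only [this]
  have h1 : ∀ u, ∑ v ∈ U, ∑ x, ∑ y, ind G u x * ind G x y * ind G v y =
      ∑ x, ∑ y, ∑ v ∈ U, ind G u x * ind G x y * ind G v y := by
    intro u
    rw [sum_comm]
    exact sum_congr rfl fun x _ => sum_comm
  simp only [h1]
  rw [sum_comm]
  exact sum_congr rfl fun x _ => sum_comm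

lemma sum_ind_mul_mat {G : SimpleGraph V} (σ : Equiv.Perm V) (U : Finset V) :
    ∑ u ∈ U, ∑ v ∈ U, ind G u v * ∑ x, ∑ y, mat σ x y * (ind G u x * ind G v y) =
      ∑ x, moved σ x * bil G (nbrVec G U x) (nbrVec G U (σ x)) := by
  simp only [bil_nbrVec]
  have : ∀ u v x, ∑ y, mat σ x y * (ind G u x * ind G v y) =
      moved σ x * (ind G u x * ind G v (σ x)) := fun u v x =>
    sum_mat σ (fun y => ind G u x * ind G v y) x
  simp only [this, mul_sum]
  rw [sum_comm]
  refine Eq.trans ?_ (sum_comm)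
  rw [sum_comm]
  refine sum_congr rfl fun u _ => ?_
  rw [sum_comm]
  exact sum_congr rfl fun x _ => sum_congr rfl fun v _ => by ring

/-- The part of the switching identity which is estimated through the spectrum. -/
def remainder (G : SimpleGraph V) (σ : Equiv.Perm V) : ℝ :=
  - bil G (degIn G (fixedPts σ)) (degIn G (fixedPts σ))
  + ∑ x, moved σ x * bil G (nbrVec G (fixedPts σ) x) (nbrVec G (fixedPts σ) (σ x))
  + ∑ u ∈ fixedPts σ, bil G (ind G u) (ind G u)
  - ∑ x, degIn G (fixedPts σ) x ^ 2
  - ∑ x, bil G (nbrVec G (fixedPts σ) x) (nbrVec G (fixedPts σ) x)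
  + 2 * ∑ u ∈ fixedPts σ, degIn G (fixedPts σ) u ^ 2

lemma switch_identity {G : SimpleGraph V} {d : ℝ} (hd : ∀ v, ∑ w, ind G v w = d)
    {σ : Equiv.Perm V} (hσ : ∀ v, σ (σ v) = v) :
    ∑ u ∈ fixedPts σ, ∑ v ∈ fixedPts σ, ∑ x, ∑ y,
        ind G u v * (ind G x y - mat σ x y) * (coind G u x * coind G v y)
    - ∑ u ∈ fixedPts σ, ∑ v ∈ fixedPts σ, ∑ x, ∑ y,
        ind G u x * ind G v y * (coind G u v * coind G x y) =
    edgesIn G (fixedPts σ) *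
        (Fintype.card V * d - (Fintype.card V - #(fixedPts σ)) - d ^ 2 + 1)
      - ((#(fixedPts σ) : ℝ) ^ 2 * d ^ 2 - #(fixedPts σ) * d ^ 2 + #(fixedPts σ) * d)
      - remainder G σ := by
  set U := fixedPts σ with hU
  have hUm : ∀ u ∈ U, σ u = u := fun u hu => (mem_filter.1 hu).2
  have hmul : ∀ u, ∑ v ∈ U, ind G u v = degIn G U u := fun u =>
    sum_congr rfl fun v _ => ind_comm G u v
  have hmul' : ∀ v, ∑ u ∈ U, ind G u v = degIn G U v := fun u => rfl
  have L : ∑ u ∈ U, ∑ v ∈ U, ∑ x, ∑ y,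
        ind G u v * (ind G x y - mat σ x y) * (coind G u x * coind G v y) =
      edgesIn G U * (Fintype.card V * d - (Fintype.card V - #U) - 2 * d ^ 2 + 1)
        - 2 * ∑ u ∈ U, degIn G U u ^ 2
        + 2 * ∑ u ∈ U, ∑ v ∈ U, ind G u v * codeg G u v
        + (∑ u ∈ U, ∑ v ∈ U, ind G u v * bil G (ind G u) (ind G v)
          - ∑ u ∈ U, ∑ v ∈ U, ind G u v * ∑ x, ∑ y, mat σ x y * (ind G u x * ind G v y)) := by
    have h1 : ∀ u ∈ U, ∀ v ∈ U, ∑ x, ∑ y,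
        ind G u v * (ind G x y - mat σ x y) * (coind G u x * coind G v y) =
        ind G u v * (Fintype.card V * d - (Fintype.card V - #U) - 2 * d ^ 2 + 1)
          - ind G u v * degIn G U u - ind G u v * degIn G U v
          + 2 * (ind G u v * codeg G u v)
          + (ind G u v * bil G (ind G u) (ind G v)
            - ind G u v * ∑ x, ∑ y, mat σ x y * (ind G u x * ind G v y)) := by
      intro u hu v hv
      have := sum_sub_mat_mul_coind hd hσ (hUm u hu) (hUm v hv)
      simp only [mul_assoc, ← mul_sum]
      rw [this]
      have hb : ∑ x, ∑ y, (ind G x y - mat σ x y) * (ind G u x * ind G v y) =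
          bil G (ind G u) (ind G v) - ∑ x, ∑ y, mat σ x y * (ind G u x * ind G v y) := by
        unfold bil
        simp only [sub_mul, sum_sub_distrib]
        congr 1
        exact sum_congr rfl fun x _ => sum_congr rfl fun y _ => by ring
      rw [hb]
      linear_combination ind_mul_self G u v
    rw [sum_congr rfl fun u hu => sum_congr rfl fun v hv => h1 u hu v hv]
    simp only [sum_add_distrib, sum_sub_distrib, ← mul_sum, ← sum_mul]
    rw [sum_comm (f := fun u v => ind G u v * degIn G U v)]
    simp only [← sum_mul, hmul, hmul', ← sq]
    simp only [edgesIn, hmul]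
    ring
  have R : ∑ u ∈ U, ∑ v ∈ U, ∑ x, ∑ y,
        ind G u x * ind G v y * (coind G u v * coind G x y) =
      (#U : ℝ) ^ 2 * d ^ 2 - ∑ y, degIn G U y ^ 2 - bil G (degIn G U) (degIn G U)
        - (#U * d ^ 2 - #U * d - ∑ u ∈ U, bil G (ind G u) (ind G u))
        - (edgesIn G U * d ^ 2 - ∑ u ∈ U, ∑ v ∈ U, ind G u v * codeg G u v
          - ∑ u ∈ U, ∑ v ∈ U, ind G u v * bil G (ind G u) (ind G v)) := by
    have h1 : ∀ u v, ∑ x, ∑ y, ind G u x * ind G v y * (coind G u v * coind G x y) =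
        coind G u v * (d ^ 2 - codeg G u v - bil G (ind G u) (ind G v)) := by
      intro u v
      rw [← hd u, sq]
      nth_rewrite 2 [hd u]
      rw [← hd v]
      unfold codeg
      rw [← sum_coind_mul, mul_sum]
      refine sum_congr rfl fun x _ => ?_
      rw [mul_sum]
      exact sum_congr rfl fun y _ => by ring
    simp only [h1]
    rw [sum_coind_mul_subset]
    have h2 : ∀ u, codeg G u u = d := by
      intro u; simp only [codeg, ind_mul_self, hd]
    simp only [mul_sub, sum_sub_distrib, ← sum_mul, sum_codeg, sum_bil_ind, h2]
    simp only [sum_const, nsmul_eq_mul, edgesIn]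
    ring
  have hτ : ∑ u ∈ U, ∑ v ∈ U, ind G u v * codeg G u v =
      ∑ x, bil G (nbrVec G U x) (nbrVec G U x) := by
    simp only [sum_codeg_mul, bil_nbrVec]
  rw [L, R, sum_ind_mul_mat, hτ, remainder, ← hU]
  ring

end Identity

section Spectral

variable {V : Type*} [Fintype V] [DecidableEq V]

/-- The adjacency matrix deviates from `lam` times the all-ones matrix by at most `κ` in
operator norm, tested on integer vectors with entries at most `(card V)²`. -/
def SpecBound (G : SimpleGraph V) (lam κ : ℝ) : Prop :=
  ∀ z w : V → ℤ, (∀ v, |z v| ≤ (Fintype.card V : ℤ) ^ 2) →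
    (∀ v, |w v| ≤ (Fintype.card V : ℤ) ^ 2) →
    |bil G (fun v => z v) (fun v => w v) - lam * (∑ v, (z v : ℝ)) * (∑ v, (w v : ℝ))| ≤
      κ * √(∑ v, (z v : ℝ) ^ 2) * √(∑ v, (w v : ℝ) ^ 2)

/-- The real vectors to which `SpecBound` applies after clearing the denominator `card V`. -/
def Admissible (f : V → ℝ) : Prop :=
  ∃ z : V → ℤ, (∀ v, |z v| ≤ (Fintype.card V : ℤ) ^ 2) ∧ ∀ v, (z v : ℝ) = Fintype.card V * f v

lemma bil_smul (G : SimpleGraph V) (c : ℝ) (f g : V → ℝ) :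
    bil G (fun v => c * f v) (fun v => c * g v) = c ^ 2 * bil G f g := by
  unfold bil
  simp only [mul_sum]
  exact sum_congr rfl fun u _ => sum_congr rfl fun v _ => by ring

lemma SpecBound.abs_bil_sub_le [Nonempty V] {G : SimpleGraph V} {lam κ : ℝ}
    (h : SpecBound G lam κ) {f g : V → ℝ} (hf : Admissible f) (hg : Admissible g) :
    |bil G f g - lam * (∑ v, f v) * (∑ v, g v)| ≤ κ * √(∑ v, f v ^ 2) * √(∑ v, g v ^ 2) := by
  obtain ⟨z, hz, hzf⟩ := hf
  obtain ⟨w, hw, hwg⟩ := hg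
  have hn : (0 : ℝ) < Fintype.card V := by exact_mod_cast Fintype.card_pos
  have := h z w hz hw
  simp only [hzf, hwg, bil_smul, mul_pow, ← mul_sum] at this
  rw [Real.sqrt_mul (by positivity), Real.sqrt_mul (by positivity),
    Real.sqrt_sq hn.le] at this
  have e : (Fintype.card V : ℝ) ^ 2 * bil G f g -
      lam * (Fintype.card V * ∑ v, f v) * (Fintype.card V * ∑ v, g v) =
      (Fintype.card V : ℝ) ^ 2 * (bil G f g - lam * (∑ v, f v) * (∑ v, g v)) := by ring
  rw [e, abs_mul, abs_of_pos (by positivity)] at this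
  have hn2 : (0 : ℝ) < (Fintype.card V : ℝ) ^ 2 := by positivity
  refine le_of_mul_le_mul_left (this.trans_eq ?_) hn2
  ring

lemma admissible_of_zero_or_one {f : V → ℝ} (h : ∀ v, f v = 0 ∨ f v = 1) : Admissible f := by
  refine ⟨fun v => if f v = 0 then 0 else Fintype.card V, fun v => ?_, fun v => ?_⟩
  · dsimp only
    split_ifs
    · simp
    · rw [abs_of_nonneg (by positivity)]
      nlinarith [Int.natCast_nonneg (Fintype.card V)]
  · dsimp only
    rcases h v with h | h <;> simp [h]

lemma degIn_nonneg (G : SimpleGraph V) (U : Finset V) (x : V) : 0 ≤ degIn G U x :=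
  sum_nonneg fun _ _ => ind_nonneg _ _ _

lemma sum_degIn {G : SimpleGraph V} {d : ℝ} (hd : ∀ v, ∑ w, ind G v w = d) (U : Finset V) :
    ∑ x, degIn G U x = #U * d := by
  unfold degIn
  rw [sum_comm]
  simp [hd]

lemma nbrVec_zero_or_one (G : SimpleGraph V) (U : Finset V) (x u : V) :
    nbrVec G U x u = 0 ∨ nbrVec G U x u = 1 := by
  unfold nbrVec
  split_ifs
  · exact ind_zero_or_one _ _ _
  · simp

lemma sum_nbrVec_sq (G : SimpleGraph V) (U : Finset V) (x : V) :
    ∑ u, nbrVec G U x u ^ 2 = degIn G U x := by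
  rw [← sum_nbrVec]
  refine sum_congr rfl fun u _ => ?_
  rcases nbrVec_zero_or_one G U x u with h | h <;> simp [h]

lemma SpecBound.bil_nbrVec [Nonempty V] {G : SimpleGraph V} {lam κ : ℝ}
    (h : SpecBound G lam κ) (hκ : 0 ≤ κ) (U : Finset V) (x y : V) :
    |bil G (nbrVec G U x) (nbrVec G U y) - lam * degIn G U x * degIn G U y| ≤
      κ * ((degIn G U x + degIn G U y) / 2) := by
  have := h.abs_bil_sub_le (admissible_of_zero_or_one (nbrVec_zero_or_one G U x))
    (admissible_of_zero_or_one (nbrVec_zero_or_one G U y))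
  rw [sum_nbrVec, sum_nbrVec, sum_nbrVec_sq, sum_nbrVec_sq] at this
  refine this.trans ?_
  rw [mul_assoc]
  gcongr
  have h1 := Real.sq_sqrt (degIn_nonneg G U x)
  have h2 := Real.sq_sqrt (degIn_nonneg G U y)
  nlinarith [sq_nonneg (√(degIn G U x) - √(degIn G U y))]

/-- The centred vector of the numbers of neighbours in `U`. -/
def dev (G : SimpleGraph V) (U : Finset V) (D : ℕ) (x : V) : ℝ :=
  degIn G U x - #U * D / Fintype.card V

section Regular

variable [Nonempty V] {G : SimpleGraph V} {D : ℕ} (hd : ∀ v, ∑ w, ind G v w = (D : ℝ))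
  (U : Finset V)

include hd

lemma degree_le_card : (D : ℝ) ≤ Fintype.card V := by
  obtain ⟨v⟩ := ‹Nonempty V›
  rw [← hd v]
  refine (sum_le_sum fun w _ => ind_le_one G v w).trans ?_
  simp

lemma sum_dev : ∑ x, dev G U D x = 0 := by
  have hn : (Fintype.card V : ℝ) ≠ 0 := by exact_mod_cast Fintype.card_ne_zero
  unfold dev
  rw [sum_sub_distrib, sum_degIn hd]
  simp
  field_simp
  ring

lemma admissible_dev : Admissible (dev G U D) := by
  have hn : (Fintype.card V : ℝ) ≠ 0 := by exact_mod_cast Fintype.card_ne_zero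
  have hcast : ∀ x, degIn G U x = (#(U.filter fun u => G.Adj u x) : ℝ) := by
    intro x; unfold degIn ind; simp
  refine ⟨fun x => Fintype.card V * #(U.filter fun u => G.Adj u x) - #U * D, fun x => ?_,
    fun x => ?_⟩
  · have h1 : #(U.filter fun u => G.Adj u x) ≤ Fintype.card V := card_le_univ _
    have h2 : #U ≤ Fintype.card V := card_le_univ _
    have h3 : D ≤ Fintype.card V := by exact_mod_cast degree_le_card hd
    have h4 := Nat.mul_le_mul_left (Fintype.card V) h1
    have h5 := Nat.mul_le_mul h2 h3
    rw [abs_le]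
    zify at h4 h5
    have : (0 : ℤ) ≤ #U * D := by positivity
    have : (0 : ℤ) ≤ Fintype.card V * #(U.filter fun u => G.Adj u x) := by positivity
    constructor <;> nlinarith
  · unfold dev
    rw [hcast]
    push_cast
    field_simp

lemma bil_const_right (f : V → ℝ) (c : ℝ) : bil G f (fun _ => c) = c * D * ∑ v, f v := by
  unfold bil
  simp only [← sum_mul, ← mul_sum, hd]
  ring

lemma bil_degIn :
    bil G (degIn G U) (degIn G U) = bil G (dev G U D) (dev G U D)
      + (#U : ℝ) ^ 2 * D ^ 3 / Fintype.card V := by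
  have hn : (Fintype.card V : ℝ) ≠ 0 := by exact_mod_cast Fintype.card_ne_zero
  set μ : ℝ := #U * D / Fintype.card V with hμ
  have h1 : bil G (dev G U D) (dev G U D) = bil G (degIn G U) (degIn G U)
      - bil G (degIn G U) (fun _ => μ) - bil G (degIn G U) (fun _ => μ)
      + bil G (fun _ => μ) (fun _ => μ) := by
    have h2 : bil G (degIn G U) (fun _ => μ) = ∑ u, ∑ v, μ * ind G u v * degIn G U v := by
      unfold bil
      rw [sum_comm]
      exact sum_congr rfl fun u _ => sum_congr rfl fun v _ => by rw [ind_comm]; ring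
    nth_rewrite 2 [h2]
    unfold bil dev
    rw [← sum_sub_distrib, ← sum_sub_distrib, ← sum_add_distrib]
    refine sum_congr rfl fun u _ => ?_
    rw [← sum_sub_distrib, ← sum_sub_distrib, ← sum_add_distrib]
    refine sum_congr rfl fun v _ => ?_
    rw [← hμ]
    ring
  rw [h1]
  simp only [bil_const_right hd, sum_degIn hd, sum_const, card_univ, nsmul_eq_mul]
  rw [hμ]
  field_simp
  ring

lemma sum_degIn_sq :
    ∑ x, degIn G U x ^ 2 = (#U : ℝ) ^ 2 * D ^ 2 / Fintype.card V + ∑ x, dev G U D x ^ 2 := by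
  have hn : (Fintype.card V : ℝ) ≠ 0 := by exact_mod_cast Fintype.card_ne_zero
  have : ∀ x, degIn G U x ^ 2 = (#U * D / Fintype.card V : ℝ) ^ 2
      + 2 * (#U * D / Fintype.card V : ℝ) * dev G U D x + dev G U D x ^ 2 := by
    intro x; unfold dev; ring
  simp only [this, sum_add_distrib, ← mul_sum, sum_dev hd, sum_const, card_univ, nsmul_eq_mul]
  field_simp
  ring

lemma sum_dev_sq_le {lam κ : ℝ} (h : SpecBound G lam κ) (hκ : 0 ≤ κ) :
    ∑ x, dev G U D x ^ 2 ≤ κ ^ 2 * #U := by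
  set S := √(∑ x, dev G U D x ^ 2) with hS
  have hS2 : S ^ 2 = ∑ x, dev G U D x ^ 2 := Real.sq_sqrt (sum_nonneg fun _ _ => sq_nonneg _)
  have h1 := h.abs_bil_sub_le (admissible_dev hd U)
    (admissible_of_zero_or_one (f := fun v => if v ∈ U then 1 else 0)
      (fun v => by split_ifs <;> simp))
  rw [sum_dev hd, ← hS] at h1
  have h2 : bil G (dev G U D) (fun v => if v ∈ U then 1 else 0) = S ^ 2 := by
    unfold bil
    have h3 : ∀ u, ∑ v, dev G U D u * ind G u v * (if v ∈ U then 1 else 0) =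
        dev G U D u ^ 2 + (#U * D / Fintype.card V) * dev G U D u := by
      intro u
      simp only [← mul_sum, mul_ite, mul_one, mul_zero, sum_ite_mem, univ_inter]
      have : ∑ v ∈ U, ind G u v = degIn G U u := sum_congr rfl fun v _ => ind_comm _ _ _
      rw [this]
      unfold dev
      ring
    simp only [h3, sum_add_distrib, ← mul_sum, sum_dev hd, hS2]
    ring
  have h4 : ∑ v, (if v ∈ U then (1 : ℝ) else 0) ^ 2 = #U := by simp
  rw [h2, h4] at h1
  have hS0 : 0 ≤ S := Real.sqrt_nonneg _
  have h5 : S ^ 2 ≤ κ * S * √(#U : ℝ) := by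
    refine (le_abs_self _).trans (le_trans (le_of_eq ?_) h1)
    congr 1; ring
  have h6 : S ≤ κ * √(#U : ℝ) := by
    rcases hS0.eq_or_lt with h0 | h0
    · rw [← h0]; positivity
    · nlinarith
  rw [← hS2, ← Real.sq_sqrt (Nat.cast_nonneg (α := ℝ) #U), ← mul_pow]
  exact pow_le_pow_left₀ hS0 h6 2

lemma abs_sum_dev_le {lam κ : ℝ} (h : SpecBound G lam κ) (hκ : 0 ≤ κ) :
    |∑ x ∈ U, dev G U D x| ≤ κ * #U := by
  refine abs_le_of_sq_le_sq ?_ (by positivity)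
  have h1 := sum_dev_sq_le hd U h hκ
  have h2 : ∑ x ∈ U, dev G U D x ^ 2 ≤ ∑ x, dev G U D x ^ 2 :=
    sum_le_sum_of_subset_of_nonneg (subset_univ _) fun _ _ _ => sq_nonneg _
  have h3 : (∑ x ∈ U, dev G U D x) ^ 2 ≤ #U * ∑ x ∈ U, dev G U D x ^ 2 := sq_sum_le_card_mul_sum_sq
  nlinarith [Nat.cast_nonneg (α := ℝ) #U]

lemma abs_bil_dev_le {lam κ : ℝ} (h : SpecBound G lam κ) (hκ : 0 ≤ κ) :
    |bil G (dev G U D) (dev G U D)| ≤ κ ^ 3 * #U := by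
  have h1 := h.abs_bil_sub_le (admissible_dev hd U) (admissible_dev hd U)
  rw [sum_dev hd, mul_assoc κ, Real.mul_self_sqrt (sum_nonneg fun _ _ => sq_nonneg _)] at h1
  have h2 := mul_le_mul_of_nonneg_left (sum_dev_sq_le hd U h hκ) hκ
  simp only [mul_zero, sub_zero] at h1
  calc _ ≤ _ := h1
    _ ≤ _ := h2
    _ = _ := by ring

lemma abs_sum_bil_nbrVec_sub_le {lam κ : ℝ} (h : SpecBound G lam κ) (hκ : 0 ≤ κ) :
    |∑ x, bil G (nbrVec G U x) (nbrVec G U x) - lam * ∑ x, degIn G U x ^ 2| ≤ κ * (#U * D) := by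
  rw [mul_sum, ← sum_sub_distrib, ← sum_degIn hd, mul_sum]
  refine (abs_sum_le_sum_abs _ _).trans (sum_le_sum fun x _ => ?_)
  refine le_trans (le_of_eq ?_) ((h.bil_nbrVec hκ U x x).trans_eq ?_)
  · congr 1; ring
  · ring

lemma abs_sum_bil_ind_sub_le {lam κ : ℝ} (h : SpecBound G lam κ) (hκ : 0 ≤ κ) :
    |∑ u ∈ U, bil G (ind G u) (ind G u) - lam * (#U * D ^ 2)| ≤ κ * (#U * D) := by
  have h0 : lam * (#U * D ^ 2) = ∑ u ∈ U, lam * D * D := by simp; ring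
  have h0' : κ * (#U * D) = ∑ u ∈ U, κ * D := by simp; ring
  rw [h0, h0', ← sum_sub_distrib]
  refine (abs_sum_le_sum_abs _ _).trans (sum_le_sum fun u _ => ?_)
  have := h.bil_nbrVec hκ univ u u
  have e : nbrVec G univ u = ind G u := by ext v; simp [nbrVec, ind_comm]
  have e' : degIn G univ u = D := by rw [← hd u]; exact sum_congr rfl fun v _ => ind_comm _ _ _
  rw [e, e'] at this
  linarith

lemma abs_sum_moved_sub_le {lam κ : ℝ} (h : SpecBound G lam κ) (hκ : 0 ≤ κ)
    (σ : Equiv.Perm V) :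
    |∑ x, moved σ x * bil G (nbrVec G U x) (nbrVec G U (σ x))
      - lam * ∑ x, moved σ x * (degIn G U x * degIn G U (σ x))| ≤ κ * (#U * D) := by
  have h0 : κ * (#U * D) = ∑ x, κ * ((degIn G U x + degIn G U (σ x)) / 2) := by
    rw [← mul_sum, ← sum_div, sum_add_distrib, Equiv.sum_comp σ (degIn G U), sum_degIn hd]
    ring
  rw [h0, mul_sum, ← sum_sub_distrib]
  refine (abs_sum_le_sum_abs _ _).trans (sum_le_sum fun x _ => ?_)
  have h1 := h.bil_nbrVec hκ U x (σ x)
  have h2 : 0 ≤ κ * ((degIn G U x + degIn G U (σ x)) / 2) := (abs_nonneg _).trans h1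
  unfold moved
  split_ifs
  · simpa using h2
  · rw [one_mul, one_mul, ← mul_assoc]; exact h1

lemma abs_sum_moved_degIn_sub_le {lam κ : ℝ} (h : SpecBound G lam κ) (hκ : 0 ≤ κ)
    (σ : Equiv.Perm V) (hU : U = fixedPts σ) :
    |∑ x, moved σ x * (degIn G U x * degIn G U (σ x))
      - (Fintype.card V - #U) * (#U * D / Fintype.card V) ^ 2| ≤
      2 * (#U * D / Fintype.card V) * (κ * #U) + κ ^ 2 * #U := by
  set μ : ℝ := #U * D / Fintype.card V with hμ
  have hμ0 : 0 ≤ μ := by positivity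
  have e : ∀ x, moved σ x * (degIn G U x * degIn G U (σ x)) =
      moved σ x * μ ^ 2 + μ * (moved σ x * dev G U D x) + μ * (moved σ x * dev G U D (σ x))
        + moved σ x * (dev G U D x * dev G U D (σ x)) := by
    intro x; unfold dev; rw [← hμ]; ring
  have m : ∀ x, moved σ x = 1 - if σ x = x then 1 else 0 := by
    intro x; unfold moved; split_ifs <;> ring
  have h1 : ∑ x, moved σ x * dev G U D x = - ∑ x ∈ U, dev G U D x := by
    simp only [m, sub_mul, sum_sub_distrib, one_mul, sum_dev hd, ite_mul, zero_mul]
    rw [hU, fixedPts, sum_filter]; ring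
  have h2 : ∑ x, moved σ x * dev G U D (σ x) = - ∑ x ∈ U, dev G U D x := by
    rw [← h1, ← Equiv.sum_comp σ (fun x => moved σ x * dev G U D x)]
    refine sum_congr rfl fun x _ => ?_
    simp [moved]
  have h3 : |∑ x, moved σ x * (dev G U D x * dev G U D (σ x))| ≤ ∑ x, dev G U D x ^ 2 := by
    have : ∑ x, dev G U D x ^ 2 = ∑ x, (dev G U D x ^ 2 + dev G U D (σ x) ^ 2) / 2 := by
      rw [← sum_div, sum_add_distrib, Equiv.sum_comp σ (fun x => dev G U D x ^ 2)]; ring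
    rw [this]
    refine (abs_sum_le_sum_abs _ _).trans (sum_le_sum fun x _ => ?_)
    unfold moved
    split_ifs
    · simp; positivity
    · rw [one_mul, abs_mul]
      nlinarith [sq_nonneg (|dev G U D x| - |dev G U D (σ x)|), sq_abs (dev G U D x),
        sq_abs (dev G U D (σ x))]
  have h4 := sum_dev_sq_le hd U h hκ
  have h5 := abs_sum_dev_le hd U h hκ
  have h6 := sum_moved σ
  rw [← hU] at h6
  simp only [e, sum_add_distrib, ← mul_sum, ← sum_mul, h1, h2, h6]
  rw [abs_le] at h3 h5 ⊢
  constructor <;> nlinarith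

lemma abs_sum_degIn_sq_sub_le {lam κ : ℝ} (h : SpecBound G lam κ) (hκ : 0 ≤ κ) :
    |∑ x ∈ U, degIn G U x ^ 2 - #U * (#U * D / Fintype.card V) ^ 2| ≤
      2 * (#U * D / Fintype.card V) * (κ * #U) + κ ^ 2 * #U := by
  set μ : ℝ := #U * D / Fintype.card V with hμ
  have hμ0 : 0 ≤ μ := by positivity
  have e : ∀ x, degIn G U x ^ 2 = μ ^ 2 + 2 * μ * dev G U D x + dev G U D x ^ 2 := by
    intro x; unfold dev; rw [← hμ]; ring
  have h2 : ∑ x ∈ U, dev G U D x ^ 2 ≤ ∑ x, dev G U D x ^ 2 :=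
    sum_le_sum_of_subset_of_nonneg (subset_univ _) fun _ _ _ => sq_nonneg _
  have h3 : 0 ≤ ∑ x ∈ U, dev G U D x ^ 2 := sum_nonneg fun _ _ => sq_nonneg _
  have h4 := sum_dev_sq_le hd U h hκ
  have h5 := abs_sum_dev_le hd U h hκ
  simp only [e, sum_add_distrib, ← mul_sum, sum_const, nsmul_eq_mul]
  rw [abs_le] at h5 ⊢
  constructor <;> nlinarith

end Regular

/-- The main term of `remainder` for `n` vertices, `r` of them fixed. -/
def remainderMain (n r d lam : ℝ) : ℝ :=
  - (r ^ 2 * d ^ 3 / n) + lam * ((n - r) * (r * d / n) ^ 2) + lam * (r * d ^ 2)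
    - (1 + lam) * (r ^ 2 * d ^ 2 / n) + 2 * (r * (r * d / n) ^ 2)

lemma abs_remainder_sub_le [Nonempty V] {G : SimpleGraph V} {D : ℕ}
    (hd : ∀ v, ∑ w, ind G v w = (D : ℝ)) {lam κ : ℝ} (h : SpecBound G lam κ) (hκ : 1 ≤ κ)
    (hκn : (Fintype.card V : ℝ) ≤ κ ^ 2) (hl0 : 0 ≤ lam) (hl1 : lam ≤ 1) (σ : Equiv.Perm V) :
    |remainder G σ - remainderMain (Fintype.card V) #(fixedPts σ) D lam| ≤
      20 * κ ^ 3 * #(fixedPts σ) := by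
  have hκ0 : 0 ≤ κ := by linarith
  set U := fixedPts σ with hU
  have hn : (0 : ℝ) < Fintype.card V := by exact_mod_cast Fintype.card_pos
  have hDn : (D : ℝ) ≤ Fintype.card V := degree_le_card hd
  have hUn : (#U : ℝ) ≤ Fintype.card V := by exact_mod_cast card_le_univ _
  have hμ : (#U * D / Fintype.card V : ℝ) ≤ κ ^ 2 := by
    rw [div_le_iff₀ hn]
    have : (0 : ℝ) ≤ #U := by positivity
    have : (0 : ℝ) ≤ D := by positivity
    nlinarith
  have hμ0 : (0 : ℝ) ≤ (#U * D / Fintype.card V : ℝ) := by positivity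
  have a1 := abs_bil_dev_le hd U h hκ0
  have a2 := sum_dev_sq_le hd U h hκ0
  have a2' : 0 ≤ ∑ x, dev G U D x ^ 2 := sum_nonneg fun _ _ => sq_nonneg _
  have a3 := abs_sum_bil_nbrVec_sub_le hd U h hκ0
  have a4 := abs_sum_bil_ind_sub_le hd U h hκ0
  have a5 := abs_sum_moved_sub_le hd U h hκ0 σ
  have a6 := abs_sum_moved_degIn_sub_le hd U h hκ0 σ hU
  have a7 := abs_sum_degIn_sq_sub_le hd U h hκ0
  rw [sum_degIn_sq hd U] at a3
  unfold remainder remainderMain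
  rw [← hU, bil_degIn hd U, sum_degIn_sq hd U]
  set μ : ℝ := #U * D / Fintype.card V
  set r : ℝ := (#U : ℝ)
  have hr : 0 ≤ r := Nat.cast_nonneg _
  have b1 : κ * (r * D) ≤ κ ^ 3 * r := by
    have : (D : ℝ) ≤ κ ^ 2 := hDn.trans hκn
    calc κ * (r * D) ≤ κ * (r * κ ^ 2) := by gcongr
      _ = _ := by ring
  have b2 : κ ^ 2 * r ≤ κ ^ 3 * r := by
    have : κ ^ 2 ≤ κ ^ 3 := pow_le_pow_right₀ hκ (by norm_num)
    gcongr
  have b3 : 2 * μ * (κ * r) ≤ 2 * (κ ^ 3 * r) := by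
    calc 2 * μ * (κ * r) ≤ 2 * κ ^ 2 * (κ * r) := by gcongr
      _ = _ := by ring
  set K := κ ^ 3 * r
  have hK : 0 ≤ K := by positivity
  have a3' := a3.trans b1
  have a4' := a4.trans b1
  have a5' := a5.trans b1
  have a6' : _ ≤ 3 * K := a6.trans (by linarith)
  have a7' : _ ≤ 3 * K := a7.trans (by linarith)
  set m1 := bil G (dev G U D) (dev G U D)
  set S := ∑ x, dev G U D x ^ 2
  have hlS : lam * S ≤ K := by nlinarith
  have hlS0 : 0 ≤ lam * S := by positivity
  set T := ∑ x, moved σ x * (degIn G U x * degIn G U (σ x))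
  have hlT : |lam * (T - (Fintype.card V - r) * μ ^ 2)| ≤ 3 * K := by
    rw [abs_mul, abs_of_nonneg hl0]
    calc lam * |T - (Fintype.card V - r) * μ ^ 2| ≤ 1 * |T - (Fintype.card V - r) * μ ^ 2| := by
          gcongr
      _ ≤ 3 * K := by rw [one_mul]; exact a6'
  rw [abs_le] at a1 a3' a4' a5' a7' hlT ⊢
  constructor <;> linarith

end Spectral

section DegreeSequences

variable {V : Type*} [Fintype V] [DecidableEq V]

/-- The graphs with degree sequence `d`. -/
def degSet (d : V → ℤ) : Finset (SimpleGraph V) :=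
  univ.filter fun G => ∀ v, ∑ w, ind G v w = d v

lemma mem_degSet {d : V → ℤ} {G : SimpleGraph V} :
    G ∈ degSet d ↔ ∀ v, ∑ w, ind G v w = d v := by simp [degSet]

/-- The neighbours of `i` other than `j` which are not neighbours of `j`. -/
def privNbrs (G : SimpleGraph V) (i j : V) : Finset V :=
  univ.filter fun x => G.Adj i x ∧ ¬ G.Adj j x ∧ x ≠ j

lemma mem_privNbrs {G : SimpleGraph V} {i j x : V} :
    x ∈ privNbrs G i j ↔ G.Adj i x ∧ ¬ G.Adj j x ∧ x ≠ j := by simp [privNbrs]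

lemma card_privNbrs_sub (G : SimpleGraph V) {i j : V} (hij : i ≠ j) :
    (#(privNbrs G i j) : ℝ) - #(privNbrs G j i) = ∑ x, ind G i x - ∑ x, ind G j x := by
  have h1 : ∀ x, (if x ∈ privNbrs G i j then (1 : ℝ) else 0) -
      (if x ∈ privNbrs G j i then (1 : ℝ) else 0) =
      ind G i x - ind G j x - (if x = j then ind G i j else 0) +
        (if x = i then ind G i j else 0) := by
    intro x
    simp only [mem_privNbrs]
    by_cases hj : x = j
    · subst hj; simp [Ne.symm hij]
    · by_cases hi : x = i
      · subst hi; simp [hij, ind_comm G j]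
      · simp only [hj, hi, if_false, ne_eq, not_false_eq_true, and_true]
        unfold ind
        by_cases a : G.Adj i x <;> by_cases b : G.Adj j x <;> simp [a, b]
  have h2 := sum_congr (rfl : (univ : Finset V) = univ) fun x _ => h1 x
  simp only [sum_add_distrib, sum_sub_distrib, sum_ite_eq', sum_ite_mem, univ_inter, sum_const,
    nsmul_eq_mul, mul_one, mem_univ, if_true] at h2
  linarith

/-- Exchange the adjacencies of `x` to `i` and to `j`, when they differ. -/
def moveNbr (i j x : V) (G : SimpleGraph V) : SimpleGraph V := toggle i x (toggle j x G)

lemma moveNbr_moveNbr (i j x : V) (G : SimpleGraph V) :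
    moveNbr j i x (moveNbr i j x G) = G := by
  unfold moveNbr
  rw [toggle_toggle, toggle_toggle]

lemma moveNbr_mem {d : V → ℤ} {i j x : V} (hij : i ≠ j) {G : SimpleGraph V}
    (hG : G ∈ degSet d) (hx : x ∈ privNbrs G i j) :
    moveNbr i j x G ∈ degSet fun v => d v - (if v = i then 1 else 0) + if v = j then 1 else 0 := by
  rw [mem_privNbrs] at hx
  simp only [degSet, mem_filter, mem_univ, true_and] at hG ⊢
  intro v
  have hix : i ≠ x := hx.1.ne
  have hjx : j ≠ x := Ne.symm hx.2.2
  unfold moveNbr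
  rw [sum_ind_toggle hix, sum_ind_toggle hjx, ind_toggle_of_ne hjx _ (by tauto) (by tauto),
    hG, ind_eq_one_iff.2 hx.1, ind_eq_zero_iff.2 hx.2.1]
  push_cast
  ring

lemma adj_moveNbr {i j x : V} (hij : i ≠ j) {G : SimpleGraph V} (hx : x ∈ privNbrs G i j) (y : V) :
    ((moveNbr i j x G).Adj i y ↔ G.Adj i y ∧ y ≠ x) ∧
      ((moveNbr i j x G).Adj j y ↔ G.Adj j y ∨ y = x) := by
  rw [mem_privNbrs] at hx
  have hix : i ≠ x := hx.1.ne
  have hjx : j ≠ x := Ne.symm hx.2.2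
  unfold moveNbr
  by_cases hy : y = x
  · subst hy
    have h1 : ind (toggle i y (toggle j y G)) i y = 0 := by
      rw [ind_toggle_self hix, ind_toggle_of_ne hjx _ (by tauto) (by tauto),
        ind_eq_one_iff.2 hx.1]
      ring
    have h2 : ind (toggle i y (toggle j y G)) j y = 1 := by
      rw [ind_toggle_of_ne hix _ (by tauto) (by tauto), ind_toggle_self hjx,
        ind_eq_zero_iff.2 hx.2.1]
      ring
    rw [ind_eq_zero_iff] at h1
    rw [ind_eq_one_iff] at h2
    simp [h1, h2]
  · rw [← ind_eq_one_iff, ← ind_eq_one_iff, ← ind_eq_one_iff, ← ind_eq_one_iff,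
      ind_toggle_of_ne hix _ (by tauto) (by tauto), ind_toggle_of_ne hjx _ (by tauto) (by tauto),
      ind_toggle_of_ne hix _ (by tauto) (by tauto), ind_toggle_of_ne hjx _ (by tauto) (by tauto)]
    tauto

lemma mem_privNbrs_moveNbr {i j x : V} (hij : i ≠ j) {G : SimpleGraph V}
    (hx : x ∈ privNbrs G i j) : x ∈ privNbrs (moveNbr i j x G) j i := by
  have h := adj_moveNbr hij hx x
  rw [mem_privNbrs, h.1, h.2]
  exact ⟨Or.inr rfl, by simp, (mem_privNbrs.1 hx).1.ne'⟩

lemma privNbrs_moveNbr {i j x : V} (hij : i ≠ j) {G : SimpleGraph V}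
    (hx : x ∈ privNbrs G i j) : privNbrs (moveNbr i j x G) i j = (privNbrs G i j).erase x := by
  ext y
  have h := adj_moveNbr hij hx y
  rw [mem_privNbrs, mem_erase, mem_privNbrs, h.1, h.2]
  tauto

/-- Transferring a unit of degree from a vertex to one of smaller degree does not decrease
the number of graphs. -/
lemma card_degSet_le_transfer (d : V → ℤ) {i j : V} (hij : d j + 1 ≤ d i) :
    #(degSet d) ≤
      #(degSet fun v => d v - (if v = i then 1 else 0) + if v = j then 1 else 0) := by
  have hne : i ≠ j := by rintro rfl; omega
  set d' : V → ℤ := fun v => d v - (if v = i then 1 else 0) + if v = j then 1 else 0 with hd'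
  have key : ∑ p ∈ (degSet d).sigma fun G => privNbrs G i j, (1 / #(privNbrs p.1 i j) : ℝ) =
      ∑ p ∈ (degSet d').sigma fun G => privNbrs G j i, (1 / (#(privNbrs p.1 i j) + 1) : ℝ) := by
    refine sum_bij' (fun p _ => ⟨moveNbr i j p.2 p.1, p.2⟩) (fun p _ => ⟨moveNbr j i p.2 p.1, p.2⟩)
      ?_ ?_ ?_ ?_ ?_
    · rintro ⟨G, x⟩ hp
      rw [mem_sigma] at hp ⊢
      exact ⟨moveNbr_mem hne hp.1 hp.2, mem_privNbrs_moveNbr hne hp.2⟩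
    · rintro ⟨G, x⟩ hp
      rw [mem_sigma] at hp ⊢
      refine ⟨?_, mem_privNbrs_moveNbr hne.symm hp.2⟩
      have := moveNbr_mem hne.symm hp.1 hp.2
      convert this using 2
      ext v
      simp only [hd']
      ring
    · rintro ⟨G, x⟩ _
      simp [moveNbr_moveNbr]
    · rintro ⟨G, x⟩ _
      simp [moveNbr_moveNbr]
    · rintro ⟨G, x⟩ hp
      rw [mem_sigma] at hp
      dsimp only at hp ⊢
      rw [privNbrs_moveNbr hne hp.2, ← card_erase_add_one hp.2]
      push_cast
      rfl
  have hleft : ∀ G ∈ degSet d, ∑ x ∈ privNbrs G i j, (1 / #(privNbrs G i j) : ℝ) = 1 := by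
    intro G hG
    have h1 := card_privNbrs_sub G hne
    have h2 := (mem_filter.1 hG).2
    rw [h2, h2] at h1
    have h3 : ((d j : ℝ) + 1 ≤ d i) := by exact_mod_cast hij
    have h4 : (0 : ℝ) ≤ #(privNbrs G j i) := by positivity
    have h5 : (0 : ℝ) < #(privNbrs G i j) := by linarith
    rw [sum_const, nsmul_eq_mul, mul_one_div_cancel h5.ne']
  have hright : ∀ G ∈ degSet d', ∑ x ∈ privNbrs G j i, (1 / (#(privNbrs G i j) + 1) : ℝ) ≤ 1 := by
    intro G hG
    have h1 := card_privNbrs_sub G hne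
    have h2 := (mem_filter.1 hG).2
    rw [h2, h2] at h1
    have h3 : ((d j : ℝ) + 1 ≤ d i) := by exact_mod_cast hij
    simp only [hd', if_true, hne, hne.symm, if_false] at h1
    push_cast at h1
    rw [sum_const, nsmul_eq_mul, mul_one_div, div_le_one (by positivity)]
    linarith
  rw [sum_sigma, sum_sigma] at key
  have h1 : (#(degSet d) : ℝ) = ∑ G ∈ degSet d, (1 : ℝ) := by simp
  have h2 : (#(degSet d') : ℝ) = ∑ G ∈ degSet d', (1 : ℝ) := by simp
  have : (#(degSet d) : ℝ) ≤ #(degSet d') := by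
    rw [h1, h2, ← sum_congr rfl hleft, key]
    exact sum_le_sum hright
  exact_mod_cast this

/-- Among all degree sequences with a given sum the constant one has the most graphs. -/
lemma card_degSet_le_const (D : ℤ) (d : V → ℤ) (hd : ∑ v, d v = Fintype.card V * D) :
    #(degSet d) ≤ #(degSet fun _ : V => D) := by
  induction hm : ∑ v, (d v - D).natAbs using Nat.strong_induction_on generalizing d with
  | _ m ih =>
  by_cases hc : ∀ v, d v = D
  · rw [show d = fun _ => D from funext hc]
  push Not at hc
  have hs : ∑ v, (d v - D) = 0 := by simp [hd]
  obtain ⟨v, hv⟩ := hc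
  have h1 : ∃ i ∈ univ, 0 < d i - D := by
    apply exists_pos_of_sum_zero_of_exists_nonzero _ hs
    exact ⟨v, mem_univ _, sub_ne_zero.2 hv⟩
  have h2 : ∃ j ∈ univ, 0 < -(d j - D) := by
    apply exists_pos_of_sum_zero_of_exists_nonzero
    · simp only [sum_neg_distrib, hs, neg_zero]
    · exact ⟨v, mem_univ _, neg_ne_zero.2 (sub_ne_zero.2 hv)⟩
  obtain ⟨i, -, hi⟩ := h1
  obtain ⟨j, -, hj⟩ := h2
  have hne : i ≠ j := by rintro rfl; omega
  refine (card_degSet_le_transfer d (i := i) (j := j) (by omega)).trans ?_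
  refine ih _ ?_ _ ?_ rfl
  · rw [← hm]
    refine sum_lt_sum (fun w _ => ?_) ⟨i, mem_univ _, ?_⟩
    · split_ifs <;> grind
    · simp only [if_true, hne, if_false]; omega
  · rw [sum_add_distrib, sum_sub_distrib, hd]
    simp

/-- The number of graphs of average degree `D` is at most `n ^ n` times the number of
`D`-regular ones. -/
lemma card_filter_sum_ind_le (D : ℕ) :
    #(univ.filter fun G : SimpleGraph V => ∑ v, ∑ w, ind G v w = Fintype.card V * D) ≤
      Fintype.card V ^ Fintype.card V * #(degSet fun _ : V => (D : ℤ)) := by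
  have hdeg : ∀ (G : SimpleGraph V) v, ∑ w, ind G v w = (#(univ.filter fun w => G.Adj v w) : ℝ) := by
    intro G v; simp [ind]
  have hlt : ∀ (G : SimpleGraph V) v, #(univ.filter fun w => G.Adj v w) < Fintype.card V := by
    intro G v
    refine card_lt_univ_of_notMem (x := v) ?_
    simp
  let f : SimpleGraph V → (V → Fin (Fintype.card V)) := fun G v =>
    ⟨#(univ.filter fun w => G.Adj v w), hlt G v⟩
  have := card_le_mul_card_image_of_maps_to (f := f)
    (s := univ.filter fun G : SimpleGraph V => ∑ v, ∑ w, ind G v w = Fintype.card V * D)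
    (t := univ) (fun _ _ => mem_univ _) #(degSet fun _ : V => (D : ℤ)) ?_
  · simp only [card_univ, Fintype.card_fun, Fintype.card_fin] at this
    linarith
  · intro b _
    by_cases hb : ∑ v, ((b v : ℕ) : ℤ) = Fintype.card V * D
    · refine (card_le_card ?_).trans (card_degSet_le_const (D : ℤ) (fun v => ((b v : ℕ) : ℤ)) hb)
      intro G hG
      simp only [mem_filter, mem_univ, true_and, degSet] at hG ⊢
      intro v
      rw [hdeg, ← hG.2]
      simp [f]
    · convert Nat.zero_le _
      rw [card_eq_zero, filter_eq_empty_iff]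
      intro G hG h
      apply hb
      have h1 := (mem_filter.1 hG).2
      simp only [hdeg] at h1
      rw [← h]
      simp only [f]
      exact_mod_cast h1

end DegreeSequences

section RandomGraph

/-- The ordered pairs `i < j`, indexing the potential edges of a graph on `Fin n`. -/
def pairs (n : ℕ) : Finset (Fin n × Fin n) := univ.filter fun q => q.1 < q.2

lemma mem_pairs {n : ℕ} {q : Fin n × Fin n} : q ∈ pairs n ↔ q.1 < q.2 := by simp [pairs]

/-- The pairs of `pairs n` which are edges of `G`. -/
def adjPairs {n : ℕ} (G : SimpleGraph (Fin n)) : Finset (Fin n × Fin n) :=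
  (pairs n).filter fun q => G.Adj q.1 q.2

lemma adjPairs_injective (n : ℕ) : Function.Injective (adjPairs (n := n)) := by
  have key : ∀ G H : SimpleGraph (Fin n), adjPairs G = adjPairs H → ∀ u v, u < v →
      (G.Adj u v ↔ H.Adj u v) := by
    intro G H h u v huv
    have := congrArg (fun s => (u, v) ∈ s) h
    simpa [adjPairs, mem_pairs, huv] using this
  intro G H h
  ext u v
  rcases lt_trichotomy u v with huv | rfl | huv
  · exact key G H h u v huv
  · simp
  · rw [G.adj_comm, H.adj_comm]; exact key G H h v u huv

lemma exists_adjPairs_eq {n : ℕ} {s : Finset (Fin n × Fin n)} (hs : s ⊆ pairs n) :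
    ∃ G, adjPairs G = s := by
  refine ⟨SimpleGraph.fromRel fun a b => (a, b) ∈ s, ?_⟩
  ext ⟨a, b⟩
  simp only [adjPairs, mem_filter, mem_pairs, SimpleGraph.fromRel_adj]
  constructor
  · rintro ⟨hab, -, h | h⟩
    · exact h
    · exact absurd (mem_pairs.1 (hs h)) (not_lt.2 hab.le)
  · intro h
    have := mem_pairs.1 (hs h)
    exact ⟨this, this.ne, Or.inl h⟩

lemma sum_graph_eq_sum_powerset {n : ℕ} (F : Finset (Fin n × Fin n) → ℝ) :
    ∑ G : SimpleGraph (Fin n), F (adjPairs G) = ∑ s ∈ (pairs n).powerset, F s := by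
  refine sum_bij (fun G _ => adjPairs G) (fun G _ => by simp [adjPairs])
    (fun G _ H _ h => adjPairs_injective n h) (fun s hs => ?_) (fun _ _ => rfl)
  obtain ⟨G, hG⟩ := exists_adjPairs_eq (mem_powerset.1 hs)
  exact ⟨G, mem_univ _, hG⟩

lemma sum_graph_prod {n : ℕ} (f g : Fin n × Fin n → ℝ) :
    ∑ G : SimpleGraph (Fin n), ∏ q ∈ pairs n, (if G.Adj q.1 q.2 then f q else g q) =
      ∏ q ∈ pairs n, (f q + g q) := by
  rw [prod_add, ← sum_graph_eq_sum_powerset fun s => (∏ i ∈ s, f i) * ∏ i ∈ pairs n \ s, g i]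
  refine sum_congr rfl fun G _ => ?_
  rw [prod_ite, adjPairs, ← filter_not]

/-- The probability of `G` in the binomial random graph with edge probability `p`. -/
def wt {n : ℕ} (p : ℝ) (G : SimpleGraph (Fin n)) : ℝ :=
  ∏ q ∈ pairs n, if G.Adj q.1 q.2 then p else 1 - p

lemma wt_nonneg {n : ℕ} {p : ℝ} (h0 : 0 ≤ p) (h1 : p ≤ 1) (G : SimpleGraph (Fin n)) :
    0 ≤ wt p G :=
  prod_nonneg fun q _ => by split_ifs <;> linarith

lemma wt_eq {n : ℕ} (p : ℝ) (G : SimpleGraph (Fin n)) :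
    wt p G = p ^ #(adjPairs G) * (1 - p) ^ (#(pairs n) - #(adjPairs G)) := by
  rw [wt, prod_ite, prod_const, prod_const]
  congr 2
  rw [filter_not, card_sdiff_of_subset (filter_subset _ _)]
  rfl

lemma exp_le_add_exp_sq (x : ℝ) : Real.exp x ≤ x + Real.exp (x ^ 2) := by
  have h := Real.add_one_le_exp (x ^ 2)
  rcases le_or_gt |x| 1 with h1 | h1
  · have := abs_le.1 (Real.abs_exp_sub_one_sub_id_le h1)
    linarith [this.2]
  · rcases lt_abs.1 h1 with h2 | h2
    · have : Real.exp x ≤ Real.exp (x ^ 2) := Real.exp_le_exp.2 (by nlinarith)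
      linarith
    · have : Real.exp x ≤ 1 := Real.exp_le_one_iff.2 (by linarith)
      nlinarith

lemma two_point_mgf_le {p : ℝ} (h0 : 0 ≤ p) (h1 : p ≤ 1) (x : ℝ) :
    p * Real.exp (x * (1 - p)) + (1 - p) * Real.exp (x * (0 - p)) ≤ Real.exp (x ^ 2) := by
  have e1 : Real.exp ((x * (1 - p)) ^ 2) ≤ Real.exp (x ^ 2) := by
    rw [Real.exp_le_exp, mul_pow]
    exact mul_le_of_le_one_right (sq_nonneg x) (by nlinarith)
  have e2 : Real.exp ((x * (0 - p)) ^ 2) ≤ Real.exp (x ^ 2) := by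
    rw [Real.exp_le_exp, mul_pow]
    exact mul_le_of_le_one_right (sq_nonneg x) (by nlinarith)
  have f1 := mul_le_mul_of_nonneg_left ((exp_le_add_exp_sq (x * (1 - p))).trans
    (add_le_add_right e1 _)) h0
  have f2 := mul_le_mul_of_nonneg_left ((exp_le_add_exp_sq (x * (0 - p))).trans
    (add_le_add_right e2 _)) (sub_nonneg.2 h1)
  linarith

/-- A linear statistic of the centred edge indicators. -/
def linStat {n : ℕ} (p : ℝ) (c : Fin n × Fin n → ℝ) (G : SimpleGraph (Fin n)) : ℝ :=
  ∑ q ∈ pairs n, c q * (ind G q.1 q.2 - p)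

lemma sum_wt_exp_linStat_le {n : ℕ} {p : ℝ} (h0 : 0 ≤ p) (h1 : p ≤ 1)
    (c : Fin n × Fin n → ℝ) (t : ℝ) :
    ∑ G : SimpleGraph (Fin n), wt p G * Real.exp (t * linStat p c G) ≤
      Real.exp (t ^ 2 * ∑ q ∈ pairs n, c q ^ 2) := by
  have : ∀ G : SimpleGraph (Fin n), wt p G * Real.exp (t * linStat p c G) =
      ∏ q ∈ pairs n, if G.Adj q.1 q.2 then p * Real.exp (t * c q * (1 - p))
        else (1 - p) * Real.exp (t * c q * (0 - p)) := by
    intro G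
    rw [linStat, mul_sum, Real.exp_sum, wt, ← prod_mul_distrib]
    refine prod_congr rfl fun q _ => ?_
    unfold ind
    split_ifs <;> simp [mul_assoc]
  simp_rw [this]
  rw [sum_graph_prod, mul_sum, Real.exp_sum]
  refine prod_le_prod (fun q _ => ?_) fun q _ => ?_
  · have := Real.exp_nonneg (t * c q * (1 - p))
    have := Real.exp_nonneg (t * c q * (0 - p))
    have := sub_nonneg.2 h1
    positivity
  · rw [← mul_pow]
    exact two_point_mgf_le h0 h1 _

lemma sum_wt_linStat_gt_le {n : ℕ} {p : ℝ} (h0 : 0 ≤ p) (h1 : p ≤ 1)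
    (c : Fin n × Fin n → ℝ) {t : ℝ} (ht : 0 ≤ t) (s : ℝ) :
    ∑ G : SimpleGraph (Fin n) with s ≤ linStat p c G, wt p G ≤
      Real.exp (t ^ 2 * ∑ q ∈ pairs n, c q ^ 2 - t * s) := by
  rw [Real.exp_sub, le_div_iff₀ (Real.exp_pos _)]
  refine le_trans ?_ (sum_wt_exp_linStat_le h0 h1 c t)
  rw [sum_mul, sum_filter]
  refine sum_le_sum fun G _ => ?_
  have hw := wt_nonneg h0 h1 G
  split_ifs with h
  · exact mul_le_mul_of_nonneg_left (Real.exp_le_exp.2 (mul_le_mul_of_nonneg_left h ht)) hw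
  · positivity

lemma sum_sum_eq_sum_pairs {n : ℕ} (F : Fin n → Fin n → ℝ) :
    ∑ u, ∑ v, F u v = ∑ q ∈ pairs n, (F q.1 q.2 + F q.2 q.1) + ∑ u, F u u := by
  have h1 : ∑ q ∈ pairs n, F q.2 q.1 = ∑ u, ∑ v, if v < u then F u v else 0 := by
    rw [pairs, sum_filter, ← univ_product_univ, sum_product_right]
  have h2 : ∑ q ∈ pairs n, F q.1 q.2 = ∑ u, ∑ v, if u < v then F u v else 0 := by
    rw [pairs, sum_filter, ← univ_product_univ, sum_product]
  rw [sum_add_distrib, h1, h2, ← sum_add_distrib, ← sum_add_distrib]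
  refine sum_congr rfl fun u _ => ?_
  have : F u u = ∑ v, if v = u then F u v else 0 := by simp
  rw [this, ← sum_add_distrib, ← sum_add_distrib]
  refine sum_congr rfl fun v _ => ?_
  rcases lt_trichotomy u v with h | rfl | h
  · simp [h, h.not_gt, h.ne']
  · simp
  · simp [h, h.not_gt, h.ne]

lemma bil_sub_eq {n : ℕ} (G : SimpleGraph (Fin n)) (p : ℝ) (z w : Fin n → ℝ) :
    bil G z w - p * (∑ v, z v) * (∑ v, w v) =
      linStat p (fun q => z q.1 * w q.2 + z q.2 * w q.1) G - p * ∑ v, z v * w v := by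
  have : bil G z w - p * (∑ v, z v) * (∑ v, w v) = ∑ u, ∑ v, z u * w v * (ind G u v - p) := by
    rw [bil, mul_assoc, sum_mul_sum, mul_sum, ← sum_sub_distrib]
    refine sum_congr rfl fun u _ => ?_
    rw [mul_sum, ← sum_sub_distrib]
    exact sum_congr rfl fun v _ => by ring
  rw [this, sum_sum_eq_sum_pairs, linStat, mul_sum, sub_eq_add_neg, ← sum_neg_distrib]
  congr 1
  · refine sum_congr rfl fun q _ => ?_
    rw [ind_comm G q.2 q.1]; ring
  · refine sum_congr rfl fun v _ => ?_
    rw [ind_self]; ring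

lemma sum_pairs_sq_le {n : ℕ} (z w : Fin n → ℝ) :
    ∑ q ∈ pairs n, (z q.1 * w q.2 + z q.2 * w q.1) ^ 2 ≤ 2 * ((∑ v, z v ^ 2) * ∑ v, w v ^ 2) := by
  rw [sum_mul_sum, sum_sum_eq_sum_pairs, mul_add, mul_sum]
  have : 0 ≤ 2 * ∑ u, z u ^ 2 * w u ^ 2 := by positivity
  refine le_add_of_le_of_nonneg (sum_le_sum fun q _ => ?_) this
  nlinarith [sq_nonneg (z q.1 * w q.2 - z q.2 * w q.1)]

/-- A failure of `SpecBound` is witnessed by a large linear statistic. -/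
lemma exists_linStat_of_not_specBound {n : ℕ} {G : SimpleGraph (Fin n)} {p κ : ℝ}
    (h0 : 0 ≤ p) (h1 : p ≤ 1) (h : ¬ SpecBound G p (κ + 1)) :
    ∃ z ∈ Fintype.piFinset fun _ : Fin n => Icc (-(n : ℤ) ^ 2) ((n : ℤ) ^ 2),
      ∃ w ∈ Fintype.piFinset fun _ : Fin n => Icc (-(n : ℤ) ^ 2) ((n : ℤ) ^ 2),
        0 < √(∑ v, (z v : ℝ) ^ 2) * √(∑ v, (w v : ℝ) ^ 2) ∧
        κ * (√(∑ v, (z v : ℝ) ^ 2) * √(∑ v, (w v : ℝ) ^ 2)) ≤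
          linStat p (fun q => (z q.1 : ℝ) * w q.2 + z q.2 * w q.1) G := by
  have main : ∀ z w : Fin n → ℤ,
      (κ + 1) * (√(∑ v, (z v : ℝ) ^ 2) * √(∑ v, (w v : ℝ) ^ 2)) <
        bil G (fun v => z v) (fun v => w v) - p * (∑ v, (z v : ℝ)) * (∑ v, (w v : ℝ)) →
      0 < √(∑ v, (z v : ℝ) ^ 2) * √(∑ v, (w v : ℝ) ^ 2) ∧
        κ * (√(∑ v, (z v : ℝ) ^ 2) * √(∑ v, (w v : ℝ) ^ 2)) ≤
          linStat p (fun q => (z q.1 : ℝ) * w q.2 + z q.2 * w q.1) G := by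
    intro z w hlt
    have hcs : |∑ v, (z v : ℝ) * w v| ≤ √(∑ v, (z v : ℝ) ^ 2) * √(∑ v, (w v : ℝ) ^ 2) := by
      rw [← Real.sqrt_mul (by positivity), ← Real.sqrt_sq_eq_abs]
      exact Real.sqrt_le_sqrt (sum_mul_sq_le_sq_mul_sq _ _ _)
    rw [bil_sub_eq G p (fun v => (z v : ℝ)) (fun v => (w v : ℝ))] at hlt
    have hb : |p * ∑ v, (z v : ℝ) * w v| ≤ √(∑ v, (z v : ℝ) ^ 2) * √(∑ v, (w v : ℝ) ^ 2) := by
      rw [abs_mul, abs_of_nonneg h0]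
      exact (mul_le_of_le_one_left (abs_nonneg _) h1).trans hcs
    refine ⟨?_, by linarith [(abs_le.1 hb).1]⟩
    by_contra h2
    have h3 : √(∑ v, (z v : ℝ) ^ 2) * √(∑ v, (w v : ℝ) ^ 2) = 0 :=
      le_antisymm (not_lt.1 h2) (by positivity)
    have h4 : linStat p (fun q => (z q.1 : ℝ) * w q.2 + z q.2 * w q.1) G = 0 := by
      have hz : (∀ v, (z v : ℝ) = 0) ∨ (∀ v, (w v : ℝ) = 0) := by
        rcases mul_eq_zero.1 h3 with h5 | h5
        · left
          rw [Real.sqrt_eq_zero (by positivity), sum_eq_zero_iff_of_nonneg fun _ _ => sq_nonneg _]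
            at h5
          exact fun v => by simpa using h5 v (mem_univ v)
        · right
          rw [Real.sqrt_eq_zero (by positivity), sum_eq_zero_iff_of_nonneg fun _ _ => sq_nonneg _]
            at h5
          exact fun v => by simpa using h5 v (mem_univ v)
      refine sum_eq_zero fun q _ => ?_
      rcases hz with hz | hz <;> simp only [hz] <;> ring
    rw [h3] at hb hlt
    have := (abs_nonpos_iff.1 hb)
    rw [h4, this] at hlt
    simp at hlt
  unfold SpecBound at h
  push Not at h
  obtain ⟨z, w, hz, hw, hlt⟩ := h
  rw [Fintype.card_fin] at hz hw
  rw [mul_assoc] at hlt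
  have hz' : z ∈ Fintype.piFinset fun _ : Fin n => Icc (-(n : ℤ) ^ 2) ((n : ℤ) ^ 2) := by
    simp only [Fintype.mem_piFinset, mem_Icc]; exact fun v => abs_le.1 (hz v)
  have hw' : w ∈ Fintype.piFinset fun _ : Fin n => Icc (-(n : ℤ) ^ 2) ((n : ℤ) ^ 2) := by
    simp only [Fintype.mem_piFinset, mem_Icc]; exact fun v => abs_le.1 (hw v)
  rcases lt_abs.1 hlt with hlt | hlt
  · exact ⟨z, hz', w, hw', main z w hlt⟩
  · have hn : -z ∈ Fintype.piFinset fun _ : Fin n => Icc (-(n : ℤ) ^ 2) ((n : ℤ) ^ 2) := by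
      simp only [Fintype.mem_piFinset, mem_Icc, Pi.neg_apply]
      exact fun v => abs_le.1 (by rw [abs_neg]; exact hz v)
    refine ⟨-z, hn, w, hw', main (-z) w ?_⟩
    simp only [Pi.neg_apply, Int.cast_neg, neg_sq, bil, neg_mul, sum_neg_distrib] at hlt ⊢
    linarith

lemma sum_wt_not_specBound_le {n : ℕ} {p κ : ℝ} (h0 : 0 ≤ p) (h1 : p ≤ 1) (hκ : 0 ≤ κ) :
    ∑ G : SimpleGraph (Fin n) with ¬ SpecBound G p (κ + 1), wt p G ≤
      (2 * (n : ℝ) ^ 2 + 1) ^ (2 * n) * Real.exp (-κ ^ 2 / 8) := by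
  set B : Finset (Fin n → ℤ) := Fintype.piFinset fun _ => Icc (-(n : ℤ) ^ 2) ((n : ℤ) ^ 2) with hB
  have hcard : (#B : ℝ) = (2 * (n : ℝ) ^ 2 + 1) ^ n := by
    rw [hB, Fintype.card_piFinset, prod_const, Int.card_Icc, card_univ, Fintype.card_fin]
    have : ((n : ℤ) ^ 2 + 1 - -(n : ℤ) ^ 2).toNat = 2 * n ^ 2 + 1 := by
      have : (n : ℤ) ^ 2 + 1 - -(n : ℤ) ^ 2 = ((2 * n ^ 2 + 1 : ℕ) : ℤ) := by push_cast; ring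
      rw [this, Int.toNat_natCast]
    rw [this]; push_cast; rfl
  let N : (Fin n → ℤ) × (Fin n → ℤ) → ℝ := fun zw =>
    √(∑ v, (zw.1 v : ℝ) ^ 2) * √(∑ v, (zw.2 v : ℝ) ^ 2)
  let X : (Fin n → ℤ) × (Fin n → ℤ) → SimpleGraph (Fin n) → ℝ := fun zw G =>
    linStat p (fun q => (zw.1 q.1 : ℝ) * zw.2 q.2 + zw.1 q.2 * zw.2 q.1) G
  have step : ∀ zw : (Fin n → ℤ) × (Fin n → ℤ),
      ∑ G : SimpleGraph (Fin n) with 0 < N zw ∧ κ * N zw ≤ X zw G, wt p G ≤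
        Real.exp (-κ ^ 2 / 8) := by
    intro zw
    by_cases hN : 0 < N zw
    · simp only [hN, true_and]
      have ht : 0 ≤ κ / (4 * N zw) := by positivity
      refine (sum_wt_linStat_gt_le h0 h1 _ ht _).trans (Real.exp_le_exp.2 ?_)
      have hs := sum_pairs_sq_le (fun v => (zw.1 v : ℝ)) (fun v => (zw.2 v : ℝ))
      have hN2 : (∑ v, (zw.1 v : ℝ) ^ 2) * (∑ v, (zw.2 v : ℝ) ^ 2) = N zw ^ 2 := by
        rw [mul_pow, Real.sq_sqrt (by positivity), Real.sq_sqrt (by positivity)]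
      rw [hN2] at hs
      have := mul_le_mul_of_nonneg_left hs (sq_nonneg (κ / (4 * N zw)))
      have e1 : (κ / (4 * N zw)) ^ 2 * (2 * N zw ^ 2) = κ ^ 2 / 8 := by field_simp; ring
      have e2 : κ / (4 * N zw) * (κ * N zw) = κ ^ 2 / 4 := by field_simp
      rw [e1] at this
      rw [e2]
      linarith
    · simp only [hN, false_and, filter_false, sum_empty]
      positivity
  have hw : ∀ G : SimpleGraph (Fin n), 0 ≤ wt p G := wt_nonneg h0 h1
  calc ∑ G : SimpleGraph (Fin n) with ¬ SpecBound G p (κ + 1), wt p G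
      ≤ ∑ G : SimpleGraph (Fin n), ∑ zw ∈ B ×ˢ B,
          if 0 < N zw ∧ κ * N zw ≤ X zw G then wt p G else 0 := by
        rw [sum_filter]
        refine sum_le_sum fun G _ => ?_
        have hnn : ∀ zw ∈ B ×ˢ B, 0 ≤ if 0 < N zw ∧ κ * N zw ≤ X zw G then wt p G else 0 :=
          fun zw _ => by split_ifs; exacts [hw G, le_rfl]
        by_cases hG : SpecBound G p (κ + 1)
        · rw [if_neg (not_not.2 hG)]
          exact sum_nonneg hnn
        · rw [if_pos hG]
          obtain ⟨z, hz, w, hw, h2⟩ := exists_linStat_of_not_specBound h0 h1 hG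
          have hzw : (z, w) ∈ B ×ˢ B := mem_product.2 ⟨hz, hw⟩
          refine le_trans ?_ (single_le_sum hnn hzw)
          rw [if_pos h2]
    _ = ∑ zw ∈ B ×ˢ B, ∑ G : SimpleGraph (Fin n) with 0 < N zw ∧ κ * N zw ≤ X zw G, wt p G := by
        rw [sum_comm]
        exact sum_congr rfl fun zw _ => (sum_filter _ _).symm
    _ ≤ ∑ zw ∈ B ×ˢ B, Real.exp (-κ ^ 2 / 8) := sum_le_sum fun zw _ => step zw
    _ = _ := by
        rw [sum_const, card_product, nsmul_eq_mul, Nat.cast_mul, hcard, two_mul n, pow_add]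

lemma factorial_mul_pow_le (e m : ℕ) : e.factorial * e ^ m ≤ m.factorial * e ^ e := by
  rcases le_total e m with h | h
  · obtain ⟨k, rfl⟩ := Nat.exists_eq_add_of_le h
    have := Nat.factorial_mul_pow_sub_le_factorial h
    rw [Nat.add_sub_cancel_left] at this
    calc e.factorial * e ^ (e + k) = (e.factorial * e ^ k) * e ^ e := by ring
      _ ≤ _ := Nat.mul_le_mul_right _ this
  · obtain ⟨k, rfl⟩ := Nat.exists_eq_add_of_le h
    have := Nat.factorial_mul_descFactorial (n := m + k) (k := k) (by omega)
    rw [Nat.add_sub_cancel] at this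
    have h2 := Nat.descFactorial_le_pow (m + k) k
    calc (m + k).factorial * (m + k) ^ m
        = m.factorial * ((m + k).descFactorial k * (m + k) ^ m) := by rw [← this]; ring
      _ ≤ m.factorial * ((m + k) ^ k * (m + k) ^ m) := by gcongr
      _ = _ := by ring

/-- A binomial variable with integer mean has its mode at the mean. -/
lemma choose_mul_pow_le (e f : ℕ) {m : ℕ} (hm : m ≤ e + f) :
    (e + f).choose m * (e ^ m * f ^ (e + f - m)) ≤ (e + f).choose e * (e ^ e * f ^ f) := by
  obtain ⟨k, hk⟩ := Nat.exists_eq_add_of_le hm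
  have hk' : e + f - m = k := by omega
  rw [hk']
  have h1 := Nat.add_choose_mul_factorial_mul_factorial e f
  have h2 := Nat.add_choose_mul_factorial_mul_factorial m k
  rw [← hk] at h2
  rw [← Nat.choose_symm_add] at h1
  rw [hk, ← Nat.choose_symm_add, ← hk] at h2
  have h3 := factorial_mul_pow_le e m
  have h4 := factorial_mul_pow_le f k
  have hpos : 0 < m.factorial * k.factorial * (e.factorial * f.factorial) := by positivity
  refine Nat.le_of_mul_le_mul_right ?_ hpos
  rw [mul_assoc] at h1 h2
  calc (e + f).choose m * (e ^ m * f ^ k) *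
        (m.factorial * k.factorial * (e.factorial * f.factorial))
      = ((e + f).choose m * (m.factorial * k.factorial)) *
          ((e.factorial * e ^ m) * (f.factorial * f ^ k)) := by ring
    _ ≤ (e + f).factorial * ((m.factorial * e ^ e) * (k.factorial * f ^ f)) := by
        rw [h2]; gcongr
    _ = ((e + f).choose e * (e.factorial * f.factorial)) *
          ((m.factorial * e ^ e) * (k.factorial * f ^ f)) := by rw [h1]
    _ = _ := by ring

lemma one_le_choose_mul_pow {N e : ℕ} (he : e ≤ N) (hN : 0 < N) :
    1 ≤ ((N : ℝ) + 1) * (N.choose e * (((e : ℝ) / N) ^ e * (1 - (e : ℝ) / N) ^ (N - e))) := by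
  obtain ⟨f, rfl⟩ := Nat.exists_eq_add_of_le he
  have hN' : ((e + f : ℕ) : ℝ) ≠ 0 := by positivity
  set p : ℝ := (e : ℝ) / (e + f : ℕ) with hp
  have hq : 1 - p = (f : ℝ) / (e + f : ℕ) := by rw [hp]; field_simp; push_cast; ring
  have h := add_pow p (1 - p) (e + f)
  rw [add_sub_cancel, one_pow] at h
  have hc : ∀ m ∈ range (e + f + 1), p ^ m * (1 - p) ^ (e + f - m) * ((e + f).choose m : ℝ) ≤
      (e + f).choose e * (p ^ e * (1 - p) ^ (e + f - e)) := by
    intro m hm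
    have hm' : m ≤ e + f := Nat.lt_succ_iff.1 (mem_range.1 hm)
    have := choose_mul_pow_le e f hm'
    have h3 : ((e + f).choose m * ((e : ℝ) ^ m * (f : ℝ) ^ (e + f - m))) ≤
      (e + f).choose e * ((e : ℝ) ^ e * (f : ℝ) ^ f) := by exact_mod_cast this
    rw [hq, hp, Nat.add_sub_cancel_left, div_pow, div_pow, div_pow, div_pow]
    have e1 : ((e + f : ℕ) : ℝ) ^ m * ((e + f : ℕ) : ℝ) ^ (e + f - m) = ((e + f : ℕ) : ℝ) ^ (e + f) := by
      rw [← pow_add]; congr 1; omega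
    rw [div_mul_div_comm, div_mul_div_comm, e1, ← pow_add, div_mul_eq_mul_div, mul_div_assoc',
      mul_comm _ (((e + f).choose m : ℕ) : ℝ)]
    gcongr
  refine h.le.trans ((sum_le_card_nsmul _ _ _ hc).trans (le_of_eq ?_))
  rw [card_range, nsmul_eq_mul]
  push_cast
  rfl

lemma card_pairs (n : ℕ) : 2 * (#(pairs n) : ℝ) = n * (n - 1) := by
  have := sum_sum_eq_sum_pairs (n := n) fun _ _ => 1
  simp only [sum_const, nsmul_eq_mul, card_univ, Fintype.card_fin, mul_one] at this
  linarith

lemma sum_sum_ind_eq {n : ℕ} (G : SimpleGraph (Fin n)) :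
    ∑ u, ∑ v, ind G u v = 2 * #(adjPairs G) := by
  rw [sum_sum_eq_sum_pairs]
  have : ∀ q ∈ pairs n, ind G q.1 q.2 + ind G q.2 q.1 = 2 * if G.Adj q.1 q.2 then 1 else 0 := by
    intro q _
    rw [ind_comm G q.2 q.1, ind]; ring
  rw [sum_congr rfl this, ← mul_sum, adjPairs, ← sum_filter]
  simp

/-- The number of graphs with the edge count of a `D`-regular graph. -/
lemma card_filter_sum_ind_eq {n D E : ℕ} (hE : n * D = 2 * E) :
    #(univ.filter fun G : SimpleGraph (Fin n) => ∑ v, ∑ w, ind G v w = n * D) =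
      (#(pairs n)).choose E := by
  rw [← card_powersetCard]
  refine card_bij (fun G _ => adjPairs G) (fun G hG => ?_) (fun G _ H _ h => adjPairs_injective n h)
    fun s hs => ?_
  · rw [mem_filter, sum_sum_ind_eq] at hG
    refine mem_powersetCard.2 ⟨filter_subset _ _, ?_⟩
    have : ((2 * #(adjPairs G) : ℕ) : ℝ) = (n * D : ℕ) := by push_cast; exact hG.2
    have := Nat.cast_injective this
    omega
  · rw [mem_powersetCard] at hs
    obtain ⟨G, hG⟩ := exists_adjPairs_eq hs.1
    refine ⟨G, mem_filter.2 ⟨mem_univ _, ?_⟩, hG⟩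
    rw [sum_sum_ind_eq, hG, hs.2]
    exact_mod_cast hE.symm

/-- Few regular graphs violate `SpecBound`. -/
lemma card_not_specBound_le {n D : ℕ} (hn : 2 ≤ n) (hD : D < n) (heven : Even (D * n)) {κ : ℝ}
    (hκ : 0 ≤ κ) :
    (#((degSet fun _ : Fin n => (D : ℤ)).filter
        fun G => ¬ SpecBound G ((D : ℝ) / (n - 1)) (κ + 1)) : ℝ) ≤
      (2 * (n : ℝ) ^ 2 + 1) ^ (2 * n) * Real.exp (-κ ^ 2 / 8) * (n : ℝ) ^ n * (n : ℝ) ^ 2 *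
        #(degSet fun _ : Fin n => (D : ℤ)) := by
  obtain ⟨E, hE⟩ := heven
  have hE2 : n * D = 2 * E := by rw [mul_comm, hE]; ring
  set N := #(pairs n) with hN
  have hNr : 2 * (N : ℝ) = n * (n - 1) := card_pairs n
  have hn' : (2 : ℝ) ≤ n := by exact_mod_cast hn
  have hNpos : 0 < N := by
    have : (0 : ℝ) < N := by nlinarith
    exact_mod_cast this
  have hEr : (n : ℝ) * D = 2 * E := by exact_mod_cast hE2
  have hDr : (D : ℝ) ≤ n - 1 := by
    have : (D : ℝ) + 1 ≤ n := by exact_mod_cast hD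
    linarith
  have hEN : E ≤ N := by
    have : (E : ℝ) ≤ N := by nlinarith
    exact_mod_cast this
  set p : ℝ := (D : ℝ) / (n - 1) with hp
  have hpE : p = (E : ℝ) / N := by
    rw [hp, div_eq_div_iff (by linarith) (by positivity)]
    nlinarith
  have hp0 : 0 ≤ p := by rw [hpE]; positivity
  have hp1 : p ≤ 1 := by rw [hp, div_le_one (by linarith)]; exact hDr
  set W : ℝ := p ^ E * (1 - p) ^ (N - E) with hW
  have hW0 : 0 ≤ W := by have := sub_nonneg.2 hp1; positivity
  have hmode := one_le_choose_mul_pow hEN hNpos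
  rw [← hpE, ← hW] at hmode
  have hcnt := card_filter_sum_ind_le (V := Fin n) D
  rw [Fintype.card_fin, card_filter_sum_ind_eq hE2, ← hN] at hcnt
  set M := #(degSet fun _ : Fin n => (D : ℤ)) with hM
  have hcnt' : (N.choose E : ℝ) ≤ (n : ℝ) ^ n * M := by exact_mod_cast hcnt
  set B := (degSet fun _ : Fin n => (D : ℤ)).filter
        fun G => ¬ SpecBound G p (κ + 1) with hB
  have hbad : (#B : ℝ) * W ≤ (2 * (n : ℝ) ^ 2 + 1) ^ (2 * n) * Real.exp (-κ ^ 2 / 8) := by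
    refine le_trans ?_ (sum_wt_not_specBound_le hp0 hp1 hκ)
    rw [← nsmul_eq_mul, ← sum_const]
    have : ∀ G ∈ B, W = wt p G := by
      intro G hG
      have h1 := mem_degSet.1 (mem_filter.1 hG).1
      have h2 : ∑ u, ∑ v, ind G u v = n * D := by simp [h1]
      rw [sum_sum_ind_eq, hEr] at h2
      have h3 : #(adjPairs G) = E := by
        have : (#(adjPairs G) : ℝ) = E := by linarith
        exact_mod_cast this
      rw [wt_eq, h3]
    rw [sum_congr rfl this]
    refine sum_le_sum_of_subset_of_nonneg (fun G hG => ?_) fun G _ _ => wt_nonneg hp0 hp1 G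
    exact mem_filter.2 ⟨mem_univ _, (mem_filter.1 hG).2⟩
  set P : ℝ := (2 * (n : ℝ) ^ 2 + 1) ^ (2 * n) * Real.exp (-κ ^ 2 / 8) with hP
  have hP0 : 0 ≤ P := by positivity
  have hN1 : (N : ℝ) + 1 ≤ (n : ℝ) ^ 2 := by nlinarith
  calc (#B : ℝ) = #B * 1 := by ring
    _ ≤ #B * (((N : ℝ) + 1) * (N.choose E * W)) := by gcongr
    _ = (#B * W) * (((N : ℝ) + 1) * N.choose E) := by ring
    _ ≤ P * ((n : ℝ) ^ 2 * ((n : ℝ) ^ n * M)) := by gcongr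
    _ = _ := by ring

end RandomGraph

section Configurations

variable {V : Type*} [Fintype V] [DecidableEq V]

lemma mem_fixedPts {σ : Equiv.Perm V} {v : V} : v ∈ fixedPts σ ↔ σ v = v := by simp [fixedPts]

lemma mem_regContaining {d : ℝ} {σ : Equiv.Perm V} {G : SimpleGraph V} :
    G ∈ regContaining d σ ↔ (∀ v, ∑ w, ind G v w = d) ∧ ∀ v, σ v ≠ v → G.Adj v (σ v) := by
  simp [regContaining]

/-- The involutions with `r` fixed points. -/
def involutions (V : Type*) [Fintype V] [DecidableEq V] (r : ℕ) : Finset (Equiv.Perm V) :=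
  univ.filter fun σ => (∀ v, σ (σ v) = v) ∧ #(fixedPts σ) = r

lemma mem_involutions {r : ℕ} {σ : Equiv.Perm V} :
    σ ∈ involutions V r ↔ (∀ v, σ (σ v) = v) ∧ #(fixedPts σ) = r := by simp [involutions]

/-- The pairs of a partial matching leaving `r` vertices uncovered (encoded as an involution)
and a `d`-regular graph containing it. -/
def configs (V : Type*) [Fintype V] [DecidableEq V] (d : ℝ) (r : ℕ) :
    Finset (Σ _ : Equiv.Perm V, SimpleGraph V) :=
  (involutions V r).sigma fun σ => regContaining d σ

lemma mem_configs {d : ℝ} {r : ℕ} {p : Σ _ : Equiv.Perm V, SimpleGraph V} :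
    p ∈ configs V d r ↔ ((∀ v, p.1 (p.1 v) = v) ∧ #(fixedPts p.1) = r) ∧
      (∀ v, ∑ w, ind p.2 v w = d) ∧ ∀ v, p.1 v ≠ v → p.2.Adj v (p.1 v) := by
  rw [configs, mem_sigma, mem_involutions, mem_regContaining]

lemma sum_edgesIn_configs (d : ℝ) (r : ℕ) :
    (∑ p ∈ configs V d r, edgesIn p.2 (fixedPts p.1)) * (Fintype.card V * d -
        (Fintype.card V - r) - d ^ 2 + 1) =
      #(configs V d r) * ((r : ℝ) ^ 2 * d ^ 2 - r * d ^ 2 + r * d) +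
        ∑ p ∈ configs V d r, remainder p.2 p.1 := by
  have key : ∀ σ ∈ involutions V r, ∑ G ∈ regContaining d σ,
      (edgesIn G (fixedPts σ) * (Fintype.card V * d - (Fintype.card V - r) - d ^ 2 + 1)
        - ((r : ℝ) ^ 2 * d ^ 2 - r * d ^ 2 + r * d) - remainder G σ) = 0 := by
    intro σ hσ
    rw [mem_involutions] at hσ
    have h1 : ∀ G ∈ regContaining d σ, edgesIn G (fixedPts σ) *
        (Fintype.card V * d - (Fintype.card V - r) - d ^ 2 + 1)
        - ((r : ℝ) ^ 2 * d ^ 2 - r * d ^ 2 + r * d) - remainder G σ =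
        ∑ u ∈ fixedPts σ, ∑ v ∈ fixedPts σ, ∑ x, ∑ y,
          ind G u v * (ind G x y - mat σ x y) * (coind G u x * coind G v y)
        - ∑ u ∈ fixedPts σ, ∑ v ∈ fixedPts σ, ∑ x, ∑ y,
          ind G u x * ind G v y * (coind G u v * coind G x y) := by
      intro G hG
      rw [switch_identity (mem_regContaining.1 hG).1 hσ.1, hσ.2]
    rw [sum_congr rfl h1, sum_sub_distrib, sub_eq_zero, sum_comm]
    conv_rhs => rw [sum_comm]
    refine sum_congr rfl fun u hu => ?_
    rw [sum_comm]
    conv_rhs => rw [sum_comm]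
    refine sum_congr rfl fun v hv => ?_
    rw [sum_comm]
    conv_rhs => rw [sum_comm]
    refine sum_congr rfl fun x _ => ?_
    rw [sum_comm]
    conv_rhs => rw [sum_comm]
    exact sum_congr rfl fun y _ => sum_switch hσ.1 (mem_fixedPts.1 hu) (mem_fixedPts.1 hv) x y
  have h2 := sum_congr rfl key
  rw [sum_const_zero, sum_sigma'] at h2
  change ∑ p ∈ configs V d r, _ = _ at h2
  rw [sum_sub_distrib, sum_sub_distrib, ← sum_mul, sum_const, nsmul_eq_mul] at h2
  linarith

lemma mul_swap_apply (σ : Equiv.Perm V) (u v x : V) :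
    (σ * Equiv.swap u v) x = if x = u then σ v else if x = v then σ u else σ x := by
  rw [Equiv.Perm.mul_apply, Equiv.swap_apply_def]
  split_ifs <;> rfl

lemma mul_swap_involutive {σ : Equiv.Perm V} (hσ : ∀ v, σ (σ v) = v) {u v : V} (huv : u ≠ v)
    (h : (σ u = u ∧ σ v = v) ∨ (σ u = v ∧ σ v = u)) (x : V) :
    (σ * Equiv.swap u v) ((σ * Equiv.swap u v) x) = x := by
  simp only [mul_swap_apply]
  have := hσ x
  grind

lemma card_fixedPts_mul_swap {σ : Equiv.Perm V} {u v : V} (huv : u ≠ v)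
    (hu : σ u = u) (hv : σ v = v) : #(fixedPts (σ * Equiv.swap u v)) + 2 = #(fixedPts σ) := by
  have : fixedPts σ = insert u (insert v (fixedPts (σ * Equiv.swap u v))) := by
    ext x
    rw [mem_insert, mem_insert, mem_fixedPts, mem_fixedPts, mul_swap_apply]
    grind
  rw [this, card_insert_of_notMem, card_insert_of_notMem]
  · rw [mem_fixedPts, mul_swap_apply]
    grind
  · rw [mem_insert, mem_fixedPts, mul_swap_apply]
    grind

lemma mul_swap_mul_swap (σ : Equiv.Perm V) (u v : V) :
    σ * Equiv.swap u v * Equiv.swap u v = σ := by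
  rw [mul_assoc, Equiv.swap_mul_self, mul_one]

/-- Adding an edge to the partial matching. -/
lemma card_configs_mul (d : ℝ) (r : ℕ) :
    (#(configs V d r) : ℝ) * (Fintype.card V - r) =
      ∑ p ∈ configs V d (r + 2), edgesIn p.2 (fixedPts p.1) := by
  have hL : (#(configs V d r) : ℝ) * (Fintype.card V - r) =
      #((configs V d r).sigma fun p => (fixedPts p.1)ᶜ) := by
    rw [card_sigma, Nat.cast_sum, ← nsmul_eq_mul, ← sum_const]
    refine sum_congr rfl fun p hp => ?_
    rw [card_compl, (mem_configs.1 hp).1.2, Nat.cast_sub]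
    rw [← (mem_configs.1 hp).1.2]
    exact card_le_univ _
  have hR : ∑ p ∈ configs V d (r + 2), edgesIn p.2 (fixedPts p.1) =
      #((configs V d (r + 2)).sigma fun p =>
        (fixedPts p.1 ×ˢ fixedPts p.1).filter fun q => p.2.Adj q.1 q.2) := by
    rw [card_sigma, Nat.cast_sum]
    refine sum_congr rfl fun p hp => ?_
    rw [edgesIn, ← sum_product', card_filter, Nat.cast_sum]
    refine sum_congr rfl fun q _ => ?_
    simp [ind]
  rw [hL, hR]
  congr 1
  refine card_bij' (fun x _ => ⟨⟨x.1.1 * Equiv.swap x.2 (x.1.1 x.2), x.1.2⟩, (x.2, x.1.1 x.2)⟩)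
    (fun y _ => ⟨⟨y.1.1 * Equiv.swap y.2.1 y.2.2, y.1.2⟩, y.2.1⟩) ?_ ?_ ?_ ?_
  · rintro ⟨⟨σ, G⟩, w⟩ hx
    rw [mem_sigma, mem_configs, mem_compl, mem_fixedPts] at hx
    obtain ⟨⟨⟨hσ, hr⟩, hd, hG⟩, hw⟩ := hx
    dsimp only at hσ hr hd hG hw ⊢
    have hww : w ≠ σ w := Ne.symm hw
    have hsw := mul_swap_apply σ w (σ w)
    have hinv := mul_swap_involutive hσ hww (Or.inr ⟨rfl, hσ w⟩)
    have h1 : (σ * Equiv.swap w (σ w)) w = w := by rw [hsw, if_pos rfl, hσ]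
    have h2 : (σ * Equiv.swap w (σ w)) (σ w) = σ w := by rw [hsw, if_neg hw, if_pos rfl]
    rw [mem_sigma, mem_configs, mem_filter, mem_product, mem_fixedPts, mem_fixedPts]
    refine ⟨⟨⟨hinv, ?_⟩, hd, ?_⟩, ⟨h1, h2⟩, hG w hw⟩
    · have := card_fixedPts_mul_swap hww h1 h2
      rw [mul_swap_mul_swap] at this
      dsimp only
      omega
    · intro v hv
      dsimp only at hv ⊢
      rw [hsw] at hv ⊢
      have := hσ v
      split_ifs at hv ⊢ with h3 h4
      · exact absurd (by rw [h3, hσ]) hv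
      · exact absurd h4.symm hv
      · exact hG v hv
  · rintro ⟨⟨σ, G⟩, u, v⟩ hx
    rw [mem_sigma, mem_configs, mem_filter, mem_product, mem_fixedPts, mem_fixedPts] at hx
    obtain ⟨⟨⟨hσ, hr⟩, hd, hG⟩, ⟨hu, hv⟩, huv⟩ := hx
    dsimp only at hσ hr hd hG hu hv huv ⊢
    have hsw := mul_swap_apply σ u v
    have hinv := mul_swap_involutive hσ huv.ne (Or.inl ⟨hu, hv⟩)
    rw [mem_sigma, mem_configs, mem_compl, mem_fixedPts]
    refine ⟨⟨⟨hinv, ?_⟩, hd, ?_⟩, ?_⟩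
    · have := card_fixedPts_mul_swap huv.ne hu hv
      dsimp only
      omega
    · intro x hx
      dsimp only at hx ⊢
      rw [hsw] at hx ⊢
      split_ifs at hx ⊢ with h3 h4
      · rw [h3, hv]; exact huv
      · rw [h4, hu]; exact huv.symm
      · exact hG x hx
    · dsimp only
      rw [hsw, if_pos rfl, hv]
      exact huv.ne'
  · rintro ⟨⟨σ, G⟩, w⟩ hx
    simp only [mul_swap_mul_swap]
  · rintro ⟨⟨σ, G⟩, u, v⟩ hx
    rw [mem_sigma, mem_configs, mem_filter, mem_product, mem_fixedPts, mem_fixedPts] at hx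
    obtain ⟨-, ⟨hu, hv⟩, huv⟩ := hx
    dsimp only at hu hv huv ⊢
    have : (σ * Equiv.swap u v) u = v := by
      rw [mul_swap_apply, if_pos rfl, hv]
    simp only [this, mul_swap_mul_swap]

lemma nat_card_neighborSet_eq_iff (G : SimpleGraph V) (v : V) (D : ℕ) :
    Nat.card (G.neighborSet v) = D ↔ ∑ w, ind G v w = (D : ℝ) := by
  have h1 : Nat.card (G.neighborSet v) = #(univ.filter fun w => G.Adj v w) :=
    Nat.subtype_card _ (by simp)
  have h2 : ∑ w, ind G v w = (#(univ.filter fun w => G.Adj v w) : ℝ) := by simp [ind]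
  rw [h1, h2, Nat.cast_inj]

lemma fixedPts_one : fixedPts (1 : Equiv.Perm V) = univ := by
  ext; simp [mem_fixedPts]

lemma card_configs_univ (D : ℕ) :
    #(configs V (D : ℝ) (Fintype.card V)) = #(degSet fun _ : V => (D : ℤ)) := by
  refine card_bij' (fun p _ => p.2) (fun G _ => ⟨1, G⟩) ?_ ?_ ?_ ?_
  · intro p hp
    rw [mem_degSet]
    simpa using (mem_configs.1 hp).2.1
  · intro G hG
    rw [mem_degSet] at hG
    rw [mem_configs]
    refine ⟨⟨fun _ => rfl, ?_⟩, by simpa using hG, fun v hv => absurd rfl hv⟩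
    rw [fixedPts_one, card_univ]
  · rintro ⟨σ, G⟩ hp
    have h := (mem_configs.1 hp).1.2
    dsimp only at h ⊢
    have h1 := (card_eq_iff_eq_univ _).1 h
    have : σ = 1 := by
      ext v
      exact mem_fixedPts.1 (h1 ▸ mem_univ v)
    rw [this]
  · intro G _; rfl

end Configurations

section Counts

lemma regCount_eq (n D : ℕ) : regCount n D = #(configs (Fin n) (D : ℝ) n) := by
  have h := card_configs_univ (V := Fin n) D
  rw [Fintype.card_fin] at h
  rw [h, regCount, gCount]
  refine Nat.subtype_card _ fun G => ?_
  rw [mem_degSet]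
  simp only [nat_card_neighborSet_eq_iff, Int.cast_natCast, SimpleGraph.edgeSet_bot,
    Set.disjoint_empty, and_true]

lemma pmPairs_eq (n D : ℕ) : pmPairs n D = #(configs (Fin n) (D : ℝ) 0) := by
  rw [pmPairs, ← Fintype.card_coe, ← Nat.card_eq_fintype_card]
  symm
  have hfix : ∀ p ∈ configs (Fin n) (D : ℝ) 0, ∀ v, p.1 v ≠ v := by
    intro p hp v hv
    have := (mem_configs.1 hp).1.2
    rw [card_eq_zero] at this
    exact notMem_empty v (this ▸ mem_fixedPts.2 hv)
  refine Nat.card_eq_of_bijective (fun p : configs (Fin n) (D : ℝ) 0 =>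
    ⟨⟨p.1.2, { verts := Set.univ
               Adj := fun u v => p.1.1 u = v
               adj_sub := fun {u v} h => h ▸ (mem_configs.1 p.2).2.2 u (hfix _ p.2 u)
               edge_vert := fun _ => Set.mem_univ _
               symm := ⟨fun u v h => h ▸ (mem_configs.1 p.2).1.1 u⟩ }⟩, ?_, ?_⟩) ⟨?_, ?_⟩
  · intro v
    rw [nat_card_neighborSet_eq_iff]
    exact (mem_configs.1 p.2).2.1 v
  · refine ⟨fun v _ => ⟨p.1.1 v, rfl, fun w hw => Eq.symm hw⟩, fun v => Set.mem_univ v⟩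
  · rintro ⟨⟨σ, G⟩, hp⟩ ⟨⟨τ, H⟩, hq⟩ h
    simp only [Subtype.mk.injEq, Sigma.mk.injEq] at h
    obtain ⟨rfl, h⟩ := h
    have h' := congrArg SimpleGraph.Subgraph.Adj (eq_of_heq h)
    simp only at h'
    have : σ = τ := by
      ext v
      have := congrFun (congrFun h' v) (σ v)
      simp only [eq_iff_iff, true_iff] at this
      rw [this]
    subst this
    rfl
  · rintro ⟨⟨G, M⟩, hG, hM⟩
    dsimp only at hG hM
    have hM1 : ∀ v, ∃! w, M.Adj v w := fun v => hM.1 (hM.2 v)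
    choose f hf hf' using hM1
    have hff : ∀ v, f (f v) = v := fun v => (hf' (f v) v (hf v).symm).symm
    have hadj : ∀ u v, f u = v ↔ M.Adj u v := fun u v =>
      ⟨fun h => h ▸ hf u, fun h => (hf' u v h).symm⟩
    have hmem : (⟨⟨f, f, hff, hff⟩, G⟩ : Σ _ : Equiv.Perm (Fin n), SimpleGraph (Fin n)) ∈
        configs (Fin n) (D : ℝ) 0 := by
      rw [mem_configs]
      refine ⟨⟨hff, ?_⟩, fun v => (nat_card_neighborSet_eq_iff G v D).1 (hG v),
        fun v _ => M.adj_sub (hf v)⟩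
      rw [card_eq_zero]
      refine eq_empty_of_forall_notMem fun v hv => ?_
      have h1 : f v = v := mem_fixedPts.1 hv
      exact (M.adj_sub (hf v)).ne h1.symm
    refine ⟨⟨_, hmem⟩, ?_⟩
    simp only [Subtype.mk.injEq, Sigma.mk.injEq, heq_eq_eq, true_and]
    ext u v
    · simp [hM.2 u]
    · exact hadj u v

end Counts

section Products

lemma abs_log_one_add_sub_le {u : ℝ} (hu : -(1 / 2) ≤ u) : |Real.log (1 + u) - u| ≤ 2 * u ^ 2 := by
  have hpos : 0 < 1 + u := by linarith
  have h1 := Real.log_le_sub_one_of_pos hpos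
  have h2 := Real.one_sub_inv_le_log_of_pos hpos
  have h3 : u - 2 * u ^ 2 ≤ 1 - (1 + u)⁻¹ := by
    have : (1 + u)⁻¹ ≤ 1 - u + 2 * u ^ 2 := by
      rw [inv_le_iff_one_le_mul₀ hpos]
      nlinarith [sq_nonneg u, mul_nonneg (sq_nonneg u) (by linarith : 0 ≤ 1 + 2 * u)]
    linarith
  rw [abs_le]
  constructor <;> nlinarith [sq_nonneg u]

lemma abs_log_one_add_sub_le_of_near {u c x : ℝ} (hc : 0 ≤ c) (hx0 : 0 ≤ x) (hx : x ≤ 1 / 2)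
    (h : |u - c| ≤ x) : |Real.log (1 + u) - c| ≤ 3 * x + 4 * c ^ 2 := by
  have h' := abs_le.1 h
  have h1 := abs_le.1 (abs_log_one_add_sub_le (u := u) (by linarith))
  have h2 : u ^ 2 ≤ 2 * c ^ 2 + x := by
    have : (u - c) ^ 2 ≤ x ^ 2 := sq_le_sq' (by linarith) h'.2
    nlinarith [sq_nonneg (u - c - c)]
  rw [abs_le]
  constructor <;> linarith

lemma sum_inv_le (m : ℕ) :
    ∑ k ∈ range m, 1 / (2 * ((m : ℝ) - k)) ≤ (1 + Real.log m) / 2 := by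
  have h1 : ∑ k ∈ range m, 1 / (2 * ((m : ℝ) - k)) = ∑ k ∈ range m, 1 / (2 * ((k : ℝ) + 1)) := by
    rw [← sum_range_reflect]
    refine sum_congr rfl fun k hk => ?_
    have : k < m := mem_range.1 hk
    rw [Nat.sub_sub, Nat.cast_sub (by omega)]
    push_cast
    congr 2
    ring
  have h2 := harmonic_le_one_add_log m
  rw [h1, harmonic] at *
  push_cast at h2
  have h3 : ∀ k ∈ range m, 1 / (2 * ((k : ℝ) + 1)) = ((k : ℝ) + 1)⁻¹ / 2 := by
    intro k _
    field_simp
  rw [sum_congr rfl h3, ← sum_div]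
  linarith

lemma sum_range_cast (m : ℕ) : ∑ k ∈ range m, (k : ℝ) = m * (m - 1) / 2 := by
  induction m with
  | zero => simp
  | succ m ih => rw [sum_range_succ, ih]; push_cast; ring

/-- The expected multiplicative correction for the `k`-th matching edge. -/
def edgeCorr (m : ℕ) (lam : ℝ) (k : ℕ) : ℝ := 2 * k * (1 - lam) / (lam * (2 * m) ^ 2)

variable {m : ℕ} {z s : ℕ → ℝ} {lam η : ℝ}

lemma growth_of_estimate (hm : 1 ≤ m) (hl0 : 0 < lam) (hl1 : lam ≤ 1) (hlm : 1 ≤ 2 * m * lam)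
    (hη : η ≤ 1) (h0 : 0 < z 0)
    (hrec : ∀ k < m, z (k + 1) * (2 * (k + 1)) = s k)
    (hest : ∀ k < m, z 0 ≤ (2 * (m : ℝ)) ^ (2 * k) * z k →
      |s k - z k * (lam * (2 * (m - k)) * (2 * (m - k) - 1)) * (1 + edgeCorr m lam k)| ≤
        z k * (lam * (2 * (m - k)) * (2 * (m - k) - 1)) * (η / (2 * (m - k)))) {k : ℕ}
    (hk : k ≤ m) : z 0 ≤ (2 * (m : ℝ)) ^ (2 * k) * z k := by
  induction k with
  | zero => simp
  | succ k ih =>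
    have hk' : k < m := hk
    have ih := ih hk'.le
    have hm' : (1 : ℝ) ≤ m := by exact_mod_cast hm
    have hkr : (k : ℝ) + 1 ≤ m := by exact_mod_cast hk
    have hk0 : (0 : ℝ) ≤ k := by positivity
    have hz : 0 < z k := pos_of_mul_pos_right (h0.trans_le ih) (by positivity)
    have hc : 0 ≤ edgeCorr m lam k := by
      have := sub_nonneg.2 hl1
      unfold edgeCorr; positivity
    set r : ℝ := 2 * (m - k) with hr
    have hr2 : 2 ≤ r := by linarith
    have hx : η / r ≤ 1 / 2 := by
      rw [div_le_iff₀ (by linarith)]; linarith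
    have h1 := (abs_le.1 (hest k hk' ih)).1
    set w := z k * (lam * r * (r - 1)) with hw
    have hw0 : z k * lam * 2 ≤ w := by
      have : 2 * 1 ≤ r * (r - 1) := mul_le_mul hr2 (by linarith) zero_le_one (by linarith)
      have := mul_le_mul_of_nonneg_left this (mul_pos hz hl0).le
      rw [hw]; linarith
    have hzl := mul_pos hz hl0
    have hs : z k * lam ≤ s k := by
      have e1 : w * (η / r) ≤ w * (1 / 2) := mul_le_mul_of_nonneg_left hx (by linarith)
      have e2 : 0 ≤ w * edgeCorr m lam k := mul_nonneg (by linarith) hc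
      nlinarith
    rw [← hrec k hk'] at hs
    have hzs : 0 < z (k + 1) := pos_of_mul_pos_left (hzl.trans_le hs) (by positivity)
    have h3 : z k ≤ (2 * (m : ℝ)) ^ 2 * z (k + 1) := by
      have e1 : z (k + 1) * (2 * ((k : ℝ) + 1)) ≤ z (k + 1) * (2 * m) := by gcongr
      have e2 : z k * lam ≤ z (k + 1) * (2 * m) := hs.trans e1
      calc z k = z k * 1 := by ring
        _ ≤ z k * (2 * m * lam) := by gcongr
        _ = 2 * m * (z k * lam) := by ring
        _ ≤ 2 * m * (z (k + 1) * (2 * m)) := by gcongr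
        _ = _ := by ring
    calc z 0 ≤ (2 * (m : ℝ)) ^ (2 * k) * z k := ih
      _ ≤ (2 * (m : ℝ)) ^ (2 * k) * ((2 * (m : ℝ)) ^ 2 * z (k + 1)) := by gcongr
      _ = _ := by rw [mul_add, pow_add]; ring

lemma ratio_eq_of_recursion (hl0 : 0 < lam) (y : ℕ → ℝ)
    (h : ∀ k < m, z (k + 1) * (2 * (k + 1)) =
      z k * (lam * (2 * ((m : ℝ) - k)) * (2 * (m - k) - 1)) * Real.exp (y k)) {k : ℕ} (hk : k ≤ m) :
    z k * (2 ^ k * k.factorial * (2 * (m - k)).factorial) =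
      z 0 * (lam ^ k * (2 * m).factorial) * Real.exp (∑ j ∈ range k, y j) := by
  induction k with
  | zero => simp
  | succ k ih =>
    have ih := ih (by omega)
    have h1 := h k hk
    obtain ⟨i, rfl⟩ := Nat.exists_eq_add_of_le hk
    have e1 : k + 1 + i - k = i + 1 := by omega
    have e2 : k + 1 + i - (k + 1) = i := by omega
    have e3 : 2 * (i + 1) = 2 * i + 1 + 1 := by ring
    rw [e1, e3, Nat.factorial_succ, Nat.factorial_succ] at ih
    rw [e2, sum_range_succ, Real.exp_add, Nat.factorial_succ k]
    push_cast at ih h1 ⊢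
    have hi : (0 : ℝ) < lam * ((2 * i + 1 + 1) * (2 * i + 1)) := by positivity
    refine mul_right_cancel₀ hi.ne' ?_
    calc z (k + 1) * (2 ^ (k + 1) * ((k + 1) * (k.factorial : ℝ)) * ((2 * i).factorial : ℝ)) *
          (lam * ((2 * i + 1 + 1) * (2 * i + 1)))
        = (z (k + 1) * (2 * ((k : ℝ) + 1))) * (2 ^ k * k.factorial * ((2 * i).factorial : ℝ) *
          (lam * ((2 * i + 1 + 1) * (2 * i + 1)))) := by ring
      _ = (z k * (2 ^ k * k.factorial * ((2 * (i : ℝ) + 1 + 1) * ((2 * i + 1) *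
          ((2 * i).factorial : ℝ))))) * Real.exp (y k) * lam *
            (lam * ((2 * i + 1 + 1) * (2 * i + 1))) := by
          rw [h1]; ring
      _ = _ := by rw [ih]; ring

lemma ratio_asymptotics {ℓ : ℝ} (hm : 1 ≤ m) (hl0 : 0 < lam) (hl1 : lam ≤ 1)
    (hlm : 1 ≤ 2 * m * lam) (hℓ1 : 1 ≤ ℓ) (hℓ : Real.log m ≤ ℓ) (hlℓ : 1 ≤ 2 * ℓ * lam)
    (hη0 : 0 ≤ η) (hη : η ≤ 1) (h0 : 0 < z 0)
    (hrec : ∀ k < m, z (k + 1) * (2 * (k + 1)) = s k)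
    (hest : ∀ k < m, z 0 ≤ (2 * (m : ℝ)) ^ (2 * k) * z k →
      |s k - z k * (lam * (2 * (m - k)) * (2 * (m - k) - 1)) * (1 + edgeCorr m lam k)| ≤
        z k * (lam * (2 * (m - k)) * (2 * (m - k) - 1)) * (η / (2 * (m - k)))) :
    ∃ err : ℝ, |err| ≤ 3 * η * ℓ + 17 * ℓ ^ 2 / m ∧
      z m / z 0 = lam ^ m * (2 * m).factorial / (2 ^ m * m.factorial) *
        Real.exp ((1 - lam) / (4 * lam) + err) := by
  have hm' : (1 : ℝ) ≤ m := by exact_mod_cast hm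
  have hgr : ∀ k < m, z 0 ≤ (2 * (m : ℝ)) ^ (2 * k) * z k := fun k hk =>
    growth_of_estimate hm hl0 hl1 hlm hη h0 hrec hest hk.le
  have hzk : ∀ k < m, 0 < z k := fun k hk =>
    pos_of_mul_pos_right (h0.trans_le (hgr k hk)) (by positivity)
  let r : ℕ → ℝ := fun k => 2 * ((m : ℝ) - k)
  have hr2 : ∀ k < m, 2 ≤ r k := by
    intro k hk
    have : (k : ℝ) + 1 ≤ m := by exact_mod_cast hk
    simp only [r]; linarith
  let w : ℕ → ℝ := fun k => z k * (lam * r k * (r k - 1))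
  have hw : ∀ k < m, 0 < w k := by
    intro k hk
    have h1 := hr2 k hk
    have h2 : 0 < r k - 1 := by linarith
    have h3 : 0 < r k := by linarith
    have := hzk k hk
    simp only [w]; positivity
  let u : ℕ → ℝ := fun k => s k / w k - 1
  have hc0 : ∀ k, 0 ≤ edgeCorr m lam k := by
    intro k
    have := sub_nonneg.2 hl1
    unfold edgeCorr; positivity
  have hu : ∀ k < m, |u k - edgeCorr m lam k| ≤ η / r k := by
    intro k hk
    have h1 : |s k - w k * (1 + edgeCorr m lam k)| ≤ w k * (η / r k) := hest k hk (hgr k hk)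
    have h2 : u k - edgeCorr m lam k = (s k - w k * (1 + edgeCorr m lam k)) / w k := by
      have := (hw k hk).ne'
      simp only [u]; field_simp; ring
    rw [h2, abs_div, abs_of_pos (hw k hk), div_le_iff₀ (hw k hk)]
    linarith
  have hηr : ∀ k < m, 0 ≤ η / r k ∧ η / r k ≤ 1 / 2 := by
    intro k hk
    have := hr2 k hk
    refine ⟨by positivity, ?_⟩
    rw [div_le_iff₀ (by linarith)]; linarith
  have hlog : ∀ k < m, |Real.log (1 + u k) - edgeCorr m lam k| ≤
      3 * (η / r k) + 4 * edgeCorr m lam k ^ 2 := fun k hk =>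
    abs_log_one_add_sub_le_of_near (hc0 k) (hηr k hk).1 (hηr k hk).2 (hu k hk)
  have hrat := ratio_eq_of_recursion (z := z) hl0 (fun k => Real.log (1 + u k)) (fun k hk => by
    have h1 : 0 < 1 + u k := by
      have := (abs_le.1 (hu k hk)).1
      have := (hηr k hk).2
      have := hc0 k
      linarith
    rw [hrec k hk, Real.exp_log h1]
    have := (hw k hk).ne'
    change s k = w k * (1 + (s k / w k - 1))
    field_simp
    ring) le_rfl
  rw [Nat.sub_self, mul_zero, Nat.factorial_zero, Nat.cast_one, mul_one] at hrat
  refine ⟨∑ k ∈ range m, Real.log (1 + u k) - (1 - lam) / (4 * lam), ?_, ?_⟩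
  · have hA : |∑ k ∈ range m, (Real.log (1 + u k) - edgeCorr m lam k)| ≤
        3 * η * ((1 + Real.log m) / 2) + 4 * (m * (ℓ / m) ^ 2 * 4) := by
      refine (abs_sum_le_sum_abs _ _).trans ?_
      have hb : ∀ k ∈ range m, |Real.log (1 + u k) - edgeCorr m lam k| ≤
          3 * η * (1 / (2 * ((m : ℝ) - k))) + 4 * ((ℓ / m) ^ 2) := by
        intro k hk
        have hk := mem_range.1 hk
        refine (hlog k hk).trans ?_
        have hkm : (k : ℝ) ≤ m := by exact_mod_cast hk.le
        have h1 : edgeCorr m lam k ≤ ℓ / m := by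
          unfold edgeCorr
          rw [div_le_div_iff₀ (by positivity) (by positivity)]
          have e1 : 2 * (k : ℝ) * (1 - lam) ≤ 2 * m * 1 := by
            gcongr
            linarith
          calc 2 * (k : ℝ) * (1 - lam) * m ≤ 2 * m * 1 * m := by gcongr
            _ = 2 * (m : ℝ) ^ 2 * 1 := by ring
            _ ≤ 2 * (m : ℝ) ^ 2 * (2 * ℓ * lam) := by gcongr
            _ = _ := by ring
        have h2 : edgeCorr m lam k ^ 2 ≤ (ℓ / m) ^ 2 := pow_le_pow_left₀ (hc0 k) h1 2
        have h3 : 3 * (η / r k) = 3 * η * (1 / (2 * ((m : ℝ) - k))) := by simp only [r]; ring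
        rw [h3]; linarith
      refine (sum_le_sum hb).trans ?_
      rw [sum_add_distrib, ← mul_sum, sum_const, card_range, nsmul_eq_mul]
      have := mul_le_mul_of_nonneg_left (sum_inv_le m) (by linarith : 0 ≤ 3 * η)
      have h5 : 0 ≤ m * (ℓ / m) ^ 2 := by positivity
      linarith
    have hB : ∑ k ∈ range m, edgeCorr m lam k =
        (1 - lam) / (4 * lam) - (1 - lam) / (4 * lam) / m := by
      have : ∀ k ∈ range m, edgeCorr m lam k = (k : ℝ) * (2 * (1 - lam) / (lam * (2 * m) ^ 2)) := by
        intro k _; unfold edgeCorr; ring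
      rw [sum_congr rfl this, ← sum_mul, sum_range_cast]
      field_simp
      ring
    rw [sum_sub_distrib, hB] at hA
    have hC : |(1 - lam) / (4 * lam) / m| ≤ ℓ ^ 2 / m := by
      have := sub_nonneg.2 hl1
      rw [abs_of_nonneg (by positivity)]
      gcongr
      rw [div_le_iff₀ (by positivity)]
      nlinarith
    have hD : 4 * (m * (ℓ / m) ^ 2 * 4) = 16 * ℓ ^ 2 / m := by field_simp; norm_num
    rw [hD] at hA
    have hE : 3 * η * ((1 + Real.log m) / 2) ≤ 3 * η * ℓ := by
      refine mul_le_mul_of_nonneg_left ?_ (by linarith)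
      linarith
    have h1 := abs_le.1 hA
    have h2 := abs_le.1 hC
    have h3 : 16 * ℓ ^ 2 / m = 16 * (ℓ ^ 2 / m) := by ring
    have h4 : 17 * ℓ ^ 2 / m = 17 * (ℓ ^ 2 / m) := by ring
    rw [h3] at h1
    rw [h4, abs_le]
    constructor <;> linarith [h1.1, h1.2, h2.1, h2.2]
  · rw [add_sub_cancel, div_eq_iff h0.ne', div_mul_eq_mul_div, div_mul_eq_mul_div,
      eq_div_iff (by positivity), hrat]
    ring

end Products

section Remainders

variable {V : Type*} [Fintype V] [DecidableEq V]

lemma abs_bil_le (G : SimpleGraph V) {f g : V → ℝ} {a : ℝ} (hf : ∀ v, |f v| ≤ a)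
    (hg : ∀ v, |g v| ≤ a) : |bil G f g| ≤ (Fintype.card V : ℝ) ^ 2 * a ^ 2 := by
  have h : ∀ u v, |f u * ind G u v * g v| ≤ a ^ 2 := by
    intro u v
    have ha : 0 ≤ a := (abs_nonneg _).trans (hf u)
    rw [abs_mul, abs_mul, abs_of_nonneg (ind_nonneg G u v)]
    calc |f u| * ind G u v * |g v| ≤ a * 1 * a :=
          mul_le_mul (mul_le_mul (hf u) (ind_le_one G u v) (ind_nonneg G u v) ha) (hg v)
            (abs_nonneg _) (by linarith)
      _ = a ^ 2 := by ring
  unfold bil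
  refine (abs_sum_le_sum_abs _ _).trans ((sum_le_card_nsmul _ _ (Fintype.card V * a ^ 2)
    fun u _ => (abs_sum_le_sum_abs _ _).trans ((sum_le_card_nsmul _ _ _ fun v _ => h u v).trans
      (le_of_eq ?_))).trans (le_of_eq ?_))
  · rw [nsmul_eq_mul, card_univ]
  · rw [nsmul_eq_mul, card_univ]; ring

lemma abs_degIn_le (G : SimpleGraph V) (U : Finset V) (x : V) :
    |degIn G U x| ≤ Fintype.card V := by
  rw [abs_of_nonneg (degIn_nonneg G U x)]
  unfold degIn
  refine (sum_le_card_nsmul _ _ 1 fun u _ => ind_le_one G u x).trans ?_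
  rw [nsmul_eq_mul, mul_one]
  exact_mod_cast card_le_univ U

lemma abs_ind_le (G : SimpleGraph V) (u v : V) : |ind G u v| ≤ 1 := by
  rw [abs_of_nonneg (ind_nonneg G u v)]; exact ind_le_one G u v

lemma abs_nbrVec_le (G : SimpleGraph V) (U : Finset V) (x u : V) : |nbrVec G U x u| ≤ 1 := by
  unfold nbrVec
  split_ifs
  · exact abs_ind_le G u x
  · simp

lemma abs_sum_le_card_mul (U : Finset V) {f : V → ℝ} {a : ℝ} (ha : 0 ≤ a) (h : ∀ v, |f v| ≤ a) :
    |∑ v ∈ U, f v| ≤ Fintype.card V * a := by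
  refine (abs_sum_le_sum_abs _ _).trans ((sum_le_card_nsmul _ _ _ fun v _ => h v).trans ?_)
  rw [nsmul_eq_mul]
  gcongr
  exact card_le_univ U

/-- The trivial bound on the remainder. -/
lemma abs_remainder_le [Nonempty V] (G : SimpleGraph V) (σ : Equiv.Perm V) :
    |remainder G σ| ≤ 7 * (Fintype.card V : ℝ) ^ 4 := by
  set n : ℝ := (Fintype.card V : ℝ) with hn
  have hn1 : 1 ≤ n := by
    rw [hn]; exact_mod_cast Fintype.card_pos
  have hn34 : n ^ 3 ≤ n ^ 4 := pow_le_pow_right₀ hn1 (by norm_num)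
  set U := fixedPts σ
  have h1 : |bil G (degIn G U) (degIn G U)| ≤ n ^ 4 :=
    (abs_bil_le G (abs_degIn_le G U) (abs_degIn_le G U)).trans (le_of_eq (by ring))
  have h2 : |∑ x, moved σ x * bil G (nbrVec G U x) (nbrVec G U (σ x))| ≤ n ^ 3 := by
    refine (abs_sum_le_card_mul univ (a := n ^ 2) (by positivity) fun x => ?_).trans
      (le_of_eq (by ring))
    have hm : |moved σ x| ≤ 1 := by unfold moved; split_ifs <;> simp
    rw [abs_mul]
    have := abs_bil_le G (abs_nbrVec_le G U x) (abs_nbrVec_le G U (σ x))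
    rw [one_pow, mul_one] at this
    exact (mul_le_of_le_one_left (abs_nonneg _) hm).trans this
  have h3 : |∑ u ∈ U, bil G (ind G u) (ind G u)| ≤ n ^ 3 :=
    (abs_sum_le_card_mul U (a := n ^ 2) (by positivity) fun u =>
      (abs_bil_le G (abs_ind_le G u) (abs_ind_le G u)).trans (le_of_eq (by ring))).trans
      (le_of_eq (by ring))
  have hsq : ∀ x, |degIn G U x ^ 2| ≤ n ^ 2 := fun x => by
    rw [abs_pow]; exact pow_le_pow_left₀ (abs_nonneg _) (abs_degIn_le G U x) 2
  have h4 : |∑ x, degIn G U x ^ 2| ≤ n ^ 3 :=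
    (abs_sum_le_card_mul univ (by positivity) hsq).trans (le_of_eq (by ring))
  have h5 : |∑ x, bil G (nbrVec G U x) (nbrVec G U x)| ≤ n ^ 3 :=
    (abs_sum_le_card_mul univ (a := n ^ 2) (by positivity) fun u =>
      (abs_bil_le G (abs_nbrVec_le G U u) (abs_nbrVec_le G U u)).trans (le_of_eq (by ring))).trans
      (le_of_eq (by ring))
  have h6 : |∑ u ∈ U, degIn G U u ^ 2| ≤ n ^ 3 :=
    (abs_sum_le_card_mul U (by positivity) hsq).trans (le_of_eq (by ring))
  have := abs_le.1 h1; have := abs_le.1 h2; have := abs_le.1 h3; have := abs_le.1 h4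
  have := abs_le.1 h5; have := abs_le.1 h6
  unfold remainder
  rw [abs_le]
  constructor <;> linarith

lemma abs_remainderMain_le {n r d lam : ℝ} (hn : 1 ≤ n) (hr0 : 0 ≤ r) (hr : r ≤ n) (hd0 : 0 ≤ d)
    (hd : d ≤ n) (hl0 : 0 ≤ lam) (hl1 : lam ≤ 1) : |remainderMain n r d lam| ≤ 7 * n ^ 4 := by
  have hn0 : 0 < n := by linarith
  have hn34 : n ^ 3 ≤ n ^ 4 := pow_le_pow_right₀ hn (by norm_num)
  have hq : r * d / n ≤ n := by
    rw [div_le_iff₀ hn0]; exact mul_le_mul hr hd hd0 hn0.le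
  have hq0 : 0 ≤ r * d / n := by positivity
  have h1 : r ^ 2 * d ^ 3 / n ≤ n ^ 4 := by
    rw [div_le_iff₀ hn0]
    calc r ^ 2 * d ^ 3 ≤ n ^ 2 * n ^ 3 := by gcongr
      _ = _ := by ring
  have h2 : lam * ((n - r) * (r * d / n) ^ 2) ≤ n ^ 3 := by
    have : 0 ≤ n - r := by linarith
    calc lam * ((n - r) * (r * d / n) ^ 2) ≤ 1 * (n * n ^ 2) := by
          gcongr
          linarith
      _ = _ := by ring
  have h3 : lam * (r * d ^ 2) ≤ n ^ 3 := by
    calc lam * (r * d ^ 2) ≤ 1 * (n * n ^ 2) := by gcongr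
      _ = _ := by ring
  have h4 : (1 + lam) * (r ^ 2 * d ^ 2 / n) ≤ 2 * n ^ 3 := by
    have : r ^ 2 * d ^ 2 / n ≤ n ^ 3 := by
      rw [div_le_iff₀ hn0]
      calc r ^ 2 * d ^ 2 ≤ n ^ 2 * n ^ 2 := by gcongr
        _ = _ := by ring
    gcongr
    linarith
  have h5 : 2 * (r * (r * d / n) ^ 2) ≤ 2 * n ^ 3 := by
    calc 2 * (r * (r * d / n) ^ 2) ≤ 2 * (n * n ^ 2) := by gcongr
      _ = _ := by ring
  have g1 : 0 ≤ r ^ 2 * d ^ 3 / n := by positivity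
  have g2 : 0 ≤ lam * ((n - r) * (r * d / n) ^ 2) := by
    have : 0 ≤ n - r := by linarith
    positivity
  have g3 : 0 ≤ lam * (r * d ^ 2) := by positivity
  have g4 : 0 ≤ (1 + lam) * (r ^ 2 * d ^ 2 / n) := by positivity
  have g5 : 0 ≤ 2 * (r * (r * d / n) ^ 2) := by positivity
  unfold remainderMain
  rw [abs_le]
  constructor <;> linarith

/-- The main terms of the switching identity agree with the prediction up to `O(r n)`. -/
lemma abs_main_sub_le {n r lam : ℝ} (hn : 1 ≤ n) (hr0 : 0 ≤ r) (hr : r ≤ n)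
    (hl0 : 0 ≤ lam) (hl1 : lam ≤ 1) :
    |(r ^ 2 * (lam * (n - 1)) ^ 2 - r * (lam * (n - 1)) ^ 2 + r * (lam * (n - 1)) +
        remainderMain n r (lam * (n - 1)) lam) -
      r * (r - 1) * (lam + (n - r) * (1 - lam) / n ^ 2) *
        (n * (lam * (n - 1)) - (n - r) - (lam * (n - 1)) ^ 2 + 1)| ≤ 40 * n * r := by
  have hn0 : 0 < n := by linarith
  set x := 1 / n with hx
  set ρ := r / n with hρ
  have hx0 : 0 ≤ x := by positivity
  have hx1 : x ≤ 1 := by rw [hx, div_le_one hn0]; exact hn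
  have hρ0 : 0 ≤ ρ := by positivity
  have hρ1 : ρ ≤ 1 := by rw [hρ, div_le_one hn0]; exact hr
  have M : ∀ i j k : ℕ, 0 ≤ x ^ i * ρ ^ j * lam ^ k ∧ x ^ i * ρ ^ j * lam ^ k ≤ 1 := fun i j k =>
    ⟨by positivity, mul_le_one₀ (mul_le_one₀ (pow_le_one₀ hx0 hx1) (by positivity)
      (pow_le_one₀ hρ0 hρ1)) (by positivity) (pow_le_one₀ hl0 hl1)⟩
  have key : (r ^ 2 * (lam * (n - 1)) ^ 2 - r * (lam * (n - 1)) ^ 2 + r * (lam * (n - 1)) +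
        remainderMain n r (lam * (n - 1)) lam) -
      r * (r - 1) * (lam + (n - r) * (1 - lam) / n ^ 2) *
        (n * (lam * (n - 1)) - (n - r) - (lam * (n - 1)) ^ 2 + 1) =
      n * r * (1 * (x ^ 0 * ρ ^ 3 * lam ^ 0) - 1 * (x ^ 0 * ρ ^ 3 * lam ^ 1) - 2 * (x ^ 0 * ρ ^ 2 * lam ^ 0) +
        1 * (x ^ 0 * ρ ^ 2 * lam ^ 1) - 1 * (x ^ 0 * ρ ^ 2 * lam ^ 2) + 1 * (x ^ 0 * ρ ^ 1 * lam ^ 0) -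
        1 * (x ^ 0 * ρ ^ 1 * lam ^ 1) + 2 * (x ^ 0 * ρ ^ 1 * lam ^ 2) - 1 * (x ^ 0 * ρ ^ 1 * lam ^ 3) +
        1 * (x ^ 0 * ρ ^ 0 * lam ^ 1) - 1 * (x ^ 0 * ρ ^ 0 * lam ^ 2) + 1 * (x ^ 0 * ρ ^ 0 * lam ^ 3) +
        1 * (x ^ 1 * ρ ^ 2 * lam ^ 2) + 1 * (x ^ 1 * ρ ^ 1 * lam ^ 0) - 3 * (x ^ 1 * ρ ^ 1 * lam ^ 2) +
        2 * (x ^ 1 * ρ ^ 1 * lam ^ 3) - 1 * (x ^ 1 * ρ ^ 0 * lam ^ 0) + 2 * (x ^ 1 * ρ ^ 0 * lam ^ 2) -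
        2 * (x ^ 1 * ρ ^ 0 * lam ^ 3) - 1 * (x ^ 2 * ρ ^ 1 * lam ^ 0) + 1 * (x ^ 2 * ρ ^ 1 * lam ^ 1) +
        1 * (x ^ 2 * ρ ^ 1 * lam ^ 2) - 1 * (x ^ 2 * ρ ^ 1 * lam ^ 3) + 1 * (x ^ 2 * ρ ^ 0 * lam ^ 0) -
        1 * (x ^ 2 * ρ ^ 0 * lam ^ 1) - 1 * (x ^ 2 * ρ ^ 0 * lam ^ 2) + 1 * (x ^ 2 * ρ ^ 0 * lam ^ 3)) := by
    unfold remainderMain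
    rw [hx, hρ]
    field_simp
    ring
  rw [key, abs_mul, abs_of_nonneg (by positivity : (0 : ℝ) ≤ n * r),
    show 40 * n * r = n * r * 40 by ring]
  refine mul_le_mul_of_nonneg_left ?_ (by positivity)
  rw [abs_le]
  constructor <;> linarith [
    (M 0 3 0).1, (M 0 3 0).2, (M 0 3 1).1, (M 0 3 1).2, (M 0 2 0).1, (M 0 2 0).2, (M 0 2 1).1,
    (M 0 2 1).2, (M 0 2 2).1, (M 0 2 2).2, (M 0 1 0).1, (M 0 1 0).2, (M 0 1 1).1, (M 0 1 1).2,
    (M 0 1 2).1, (M 0 1 2).2, (M 0 1 3).1, (M 0 1 3).2, (M 0 0 1).1, (M 0 0 1).2, (M 0 0 2).1,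
    (M 0 0 2).2, (M 0 0 3).1, (M 0 0 3).2, (M 1 2 2).1, (M 1 2 2).2, (M 1 1 0).1, (M 1 1 0).2,
    (M 1 1 2).1, (M 1 1 2).2, (M 1 1 3).1, (M 1 1 3).2, (M 1 0 0).1, (M 1 0 0).2, (M 1 0 2).1,
    (M 1 0 2).2, (M 1 0 3).1, (M 1 0 3).2, (M 2 1 0).1, (M 2 1 0).2, (M 2 1 1).1, (M 2 1 1).2,
    (M 2 1 2).1, (M 2 1 2).2, (M 2 1 3).1, (M 2 1 3).2, (M 2 0 0).1, (M 2 0 0).2, (M 2 0 1).1,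
    (M 2 0 1).2, (M 2 0 2).1, (M 2 0 2).2, (M 2 0 3).1, (M 2 0 3).2]

end Remainders

section Estimate

lemma mem_degSet_of_mem_configs {n D r : ℕ} {p : Σ _ : Equiv.Perm (Fin n), SimpleGraph (Fin n)}
    (hp : p ∈ configs (Fin n) (D : ℝ) r) : p.2 ∈ degSet fun _ : Fin n => (D : ℤ) := by
  rw [mem_degSet]
  intro v
  have := (mem_configs.1 hp).2.1 v
  push_cast
  exact this

/-- Few configurations involve a graph violating the spectral bound. -/
lemma card_configs_filter_le {n D r : ℕ} (P : SimpleGraph (Fin n) → Prop) :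
    (#((configs (Fin n) (D : ℝ) r).filter fun p => ¬ P p.2) : ℝ) ≤
      (n : ℝ) ^ n * #((degSet fun _ : Fin n => (D : ℤ)).filter fun G => ¬ P G) := by
  have h : (configs (Fin n) (D : ℝ) r).filter (fun p => ¬ P p.2) ⊆
      (univ : Finset (Equiv.Perm (Fin n))).sigma
        fun _ => (degSet fun _ : Fin n => (D : ℤ)).filter fun G => ¬ P G := by
    intro p hp
    rw [mem_filter] at hp
    rw [mem_sigma, mem_filter]
    exact ⟨mem_univ _, mem_degSet_of_mem_configs hp.1, hp.2⟩
  have h2 := card_le_card h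
  rw [card_sigma, sum_const, smul_eq_mul, card_univ, Fintype.card_perm, Fintype.card_fin] at h2
  have h3 : (n.factorial : ℝ) ≤ (n : ℝ) ^ n := by exact_mod_cast Nat.factorial_le_pow n
  calc _ ≤ ((n.factorial * #((degSet fun _ : Fin n => (D : ℤ)).filter fun G => ¬ P G) : ℕ) : ℝ) :=
        by exact_mod_cast h2
    _ ≤ _ := by push_cast; gcongr

/-- The spectral parameter on `n` vertices. -/
def kappa (n : ℕ) : ℝ := √(160 * n * Real.log n) + 1

lemma one_le_kappa (n : ℕ) : 1 ≤ kappa n := by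
  unfold kappa; linarith [Real.sqrt_nonneg (160 * n * Real.log n)]

lemma exp_kappa {n : ℕ} (hn : 1 ≤ n) :
    Real.exp (-(√(160 * n * Real.log n)) ^ 2 / 8) * (n : ℝ) ^ (20 * n) = 1 := by
  have hn1 : (1 : ℝ) ≤ n := by exact_mod_cast hn
  have hlog : 0 ≤ Real.log n := Real.log_nonneg hn1
  rw [Real.sq_sqrt (by positivity)]
  have h : (n : ℝ) ^ (20 * n) = Real.exp ((20 * n : ℕ) * Real.log n) := by
    rw [Real.exp_nat_mul, Real.exp_log (by linarith)]
  rw [h, ← Real.exp_add, Real.exp_eq_one_iff]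
  push_cast
  ring

lemma card_bad_configs_le {n D r : ℕ} (hn : 14 ≤ n) (hD : D < n) (heven : Even (D * n))
    (hN : (#(degSet fun _ : Fin n => (D : ℤ)) : ℝ) ≤
      (n : ℝ) ^ n * #(configs (Fin n) (D : ℝ) r)) :
    14 * (n : ℝ) ^ 4 * #((configs (Fin n) (D : ℝ) r).filter fun p =>
      ¬ SpecBound p.2 ((D : ℝ) / (n - 1)) (kappa n)) ≤ #(configs (Fin n) (D : ℝ) r) := by
  set Z : ℝ := (#(configs (Fin n) (D : ℝ) r) : ℝ) with hZ
  have hn1 : (14 : ℝ) ≤ n := by exact_mod_cast hn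
  have h1 := card_configs_filter_le (n := n) (D := D) (r := r)
    fun G => SpecBound G ((D : ℝ) / (n - 1)) (kappa n)
  have h2 := card_not_specBound_le (by omega : 2 ≤ n) hD heven
    (Real.sqrt_nonneg (160 * n * Real.log n))
  set e := Real.exp (-(√(160 * n * Real.log n)) ^ 2 / 8) with he
  have he0 : 0 < e := Real.exp_pos _
  have h3 : (2 * (n : ℝ) ^ 2 + 1) ^ (2 * n) ≤ ((n : ℝ) ^ 3) ^ (2 * n) := by
    gcongr
    nlinarith [mul_nonneg (sq_nonneg (n : ℝ)) (by linarith : (0 : ℝ) ≤ n - 14)]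
  calc _ ≤ (n : ℝ) * (n : ℝ) ^ 4 * ((n : ℝ) ^ n * (((n : ℝ) ^ 3) ^ (2 * n) * e * (n : ℝ) ^ n *
        (n : ℝ) ^ 2 * ((n : ℝ) ^ n * Z))) := by
        refine mul_le_mul (by gcongr) (h1.trans ?_) (by positivity) (by positivity)
        refine mul_le_mul_of_nonneg_left (h2.trans ?_) (by positivity)
        exact mul_le_mul (by gcongr) hN (by positivity) (by positivity)
    _ = e * (n : ℝ) ^ (9 * n + 7) * Z := by
        rw [← pow_mul]; ring
    _ ≤ e * (n : ℝ) ^ (20 * n) * Z := by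
        gcongr
        · linarith
        · omega
    _ = Z := by rw [exp_kappa (by omega), one_mul]

lemma abs_sum_remainder_sub_le {n D r : ℕ} (hn : 14 ≤ n) (hlog : 1 ≤ Real.log n) (hD : D < n)
    (hr : r ≤ n) (heven : Even (D * n))
    (hN : (#(degSet fun _ : Fin n => (D : ℤ)) : ℝ) ≤
      (n : ℝ) ^ n * #(configs (Fin n) (D : ℝ) r)) :
    |∑ p ∈ configs (Fin n) (D : ℝ) r, remainder p.2 p.1 -
      #(configs (Fin n) (D : ℝ) r) * remainderMain n r D ((D : ℝ) / (n - 1))| ≤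
    #(configs (Fin n) (D : ℝ) r) * (20 * kappa n ^ 3 * r + 1) := by
  have hn1 : (14 : ℝ) ≤ n := by exact_mod_cast hn
  have hrn : (r : ℝ) ≤ n := by exact_mod_cast hr
  have hDn : (D : ℝ) ≤ n - 1 := by
    have : (D : ℝ) + 1 ≤ n := by exact_mod_cast hD
    linarith
  have : Nonempty (Fin n) := ⟨⟨0, by omega⟩⟩
  set lam : ℝ := (D : ℝ) / (n - 1) with hlam
  have hl0 : 0 ≤ lam := div_nonneg (by positivity) (by linarith)
  have hl1 : lam ≤ 1 := (div_le_one (by linarith)).2 hDn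
  have hκ := one_le_kappa n
  have hκn : ((Fintype.card (Fin n) : ℕ) : ℝ) ≤ kappa n ^ 2 := by
    rw [Fintype.card_fin]
    have h1 : √(160 * n * Real.log n) ^ 2 = 160 * n * Real.log n :=
      Real.sq_sqrt (by positivity)
    have h2 : (n : ℝ) * 1 ≤ n * Real.log n := by gcongr
    have h3 := Real.sqrt_nonneg (160 * n * Real.log n)
    unfold kappa
    nlinarith
  have hRM : |remainderMain n r D lam| ≤ 7 * (n : ℝ) ^ 4 :=
    abs_remainderMain_le (by linarith) (by positivity) hrn (by positivity) (by linarith) hl0 hl1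
  have hp : ∀ p ∈ configs (Fin n) (D : ℝ) r, |remainder p.2 p.1 - remainderMain n r D lam| ≤
      20 * kappa n ^ 3 * r +
        if ¬ SpecBound p.2 lam (kappa n) then 14 * (n : ℝ) ^ 4 else 0 := by
    intro p hp
    have hp' := mem_configs.1 hp
    split_ifs with h
    · have h1 := abs_remainder_sub_le hp'.2.1 h hκ hκn hl0 hl1 p.1
      rw [hp'.1.2, Fintype.card_fin] at h1
      rw [add_zero]
      exact h1
    · have h1 := abs_remainder_le p.2 p.1
      rw [Fintype.card_fin] at h1
      have h2 := abs_sub (remainder p.2 p.1) (remainderMain n r D lam)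
      have h3 : 0 ≤ 20 * kappa n ^ 3 * r := by positivity
      linarith
  have hbad := card_bad_configs_le hn hD heven hN
  rw [← nsmul_eq_mul, ← sum_const, ← sum_sub_distrib]
  refine (abs_sum_le_sum_abs _ _).trans ((sum_le_sum hp).trans ?_)
  rw [sum_add_distrib, sum_const, nsmul_eq_mul, ← sum_filter, sum_const, nsmul_eq_mul]
  linarith

/-- The error allowed in one step of the recursion. -/
def stepErr (n : ℕ) : ℝ :=
  32 * Real.log n ^ 2 * (20 * kappa n ^ 3 + 1 + 40 * n) / (n : ℝ) ^ 2

lemma switch_count_ge {n r D L : ℝ} (hL : 1 ≤ L) (hr0 : 0 ≤ r) (hLn : 8 * L ≤ n)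
    (h1 : n ≤ 2 * L * D) (h2 : n ≤ 2 * L * (n - D)) :
    n ^ 2 / (8 * L) ≤ n * D - (n - r) - D ^ 2 + 1 := by
  rw [div_le_iff₀ (by positivity)]
  have hn : 0 ≤ n := by linarith
  have h3 : n ^ 2 ≤ 4 * L * (D * (n - D)) := by
    rcases le_total D (n / 2) with h | h
    · nlinarith [mul_le_mul_of_nonneg_right h1 hn, mul_nonneg (by linarith : 0 ≤ 2 * L * D)
        (by linarith : 0 ≤ n / 2 - D)]
    · nlinarith [mul_le_mul_of_nonneg_right h2 hn,
        mul_nonneg (by linarith : 0 ≤ 2 * L * (n - D)) (by linarith : 0 ≤ D - n / 2)]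
  nlinarith [mul_le_mul_of_nonneg_right hLn hn, mul_nonneg hr0 (by linarith : 0 ≤ L)]

lemma abs_sum_edgesIn_sub_le {n D r : ℕ} (hn : 14 ≤ n) (hlog : 1 ≤ Real.log n) (hD : D < n)
    (hr2 : 2 ≤ r) (hr : r ≤ n) (heven : Even (D * n))
    (hLn : 8 * Real.log n ≤ n) (h1 : (n : ℝ) ≤ 2 * Real.log n * D)
    (h2 : (n : ℝ) ≤ 2 * Real.log n * (n - 1 - D))
    (hN : (#(degSet fun _ : Fin n => (D : ℤ)) : ℝ) ≤
      (n : ℝ) ^ n * #(configs (Fin n) (D : ℝ) r)) :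
    |∑ p ∈ configs (Fin n) (D : ℝ) r, edgesIn p.2 (fixedPts p.1) -
      #(configs (Fin n) (D : ℝ) r) * (r * (r - 1) *
        ((D : ℝ) / (n - 1) + (n - r) * (1 - (D : ℝ) / (n - 1)) / (n : ℝ) ^ 2))| ≤
    #(configs (Fin n) (D : ℝ) r) * ((D : ℝ) / (n - 1) * r * (r - 1)) * (stepErr n / r) := by
  have hn1 : (14 : ℝ) ≤ n := by exact_mod_cast hn
  have hrn : (r : ℝ) ≤ n := by exact_mod_cast hr
  have hr2' : (2 : ℝ) ≤ r := by exact_mod_cast hr2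
  have hDn : (D : ℝ) ≤ n - 1 := by
    have : (D : ℝ) + 1 ≤ n := by exact_mod_cast hD
    linarith
  have hrem := abs_sum_remainder_sub_le hn hlog hD hr heven hN
  have hsw := sum_edgesIn_configs (V := Fin n) (D : ℝ) r
  rw [Fintype.card_fin] at hsw
  set lam : ℝ := (D : ℝ) / (n - 1) with hlam
  set L := Real.log n
  set S := ∑ p ∈ configs (Fin n) (D : ℝ) r, edgesIn p.2 (fixedPts p.1)
  set R := ∑ p ∈ configs (Fin n) (D : ℝ) r, remainder p.2 p.1
  set Z : ℝ := (#(configs (Fin n) (D : ℝ) r) : ℝ)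
  have hZ : 0 ≤ Z := by positivity
  have hl0 : 0 ≤ lam := div_nonneg (by positivity) (by linarith)
  have hl1 : lam ≤ 1 := (div_le_one (by linarith)).2 hDn
  have hDl : (D : ℝ) = lam * (n - 1) := by
    rw [hlam, div_mul_cancel₀]; linarith
  have hmain := abs_main_sub_le (n := n) (r := r) (by linarith) (by linarith) hrn hl0 hl1
  rw [← hDl] at hmain
  have hK := switch_count_ge hlog (by linarith : (0 : ℝ) ≤ r) hLn h1
    (h2.trans (by nlinarith))
  set K := (n : ℝ) * D - (n - r) - (D : ℝ) ^ 2 + 1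
  set P := (r : ℝ) * (r - 1) * (lam + (n - r) * (1 - lam) / (n : ℝ) ^ 2)
  set Q := (r : ℝ) ^ 2 * (D : ℝ) ^ 2 - r * (D : ℝ) ^ 2 + r * D
  set RM := remainderMain n r D lam
  set E := 20 * kappa n ^ 3 + 1 + 40 * n with hE
  have hE0 : 0 ≤ E := by have := one_le_kappa n; positivity
  have hSK : |S - Z * P| * K ≤ Z * (r * E) := by
    have hK0 : 0 ≤ K := le_trans (by positivity) hK
    have : (S - Z * P) * K = (R - Z * RM) + Z * (Q + RM - P * K) := by linarith
    rw [show |S - Z * P| * K = |(S - Z * P) * K| by rw [abs_mul, abs_of_nonneg hK0], this]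
    refine (abs_add_le _ _).trans ?_
    rw [abs_mul, abs_of_nonneg hZ]
    have h3 := mul_le_mul_of_nonneg_left hmain hZ
    refine (add_le_add hrem h3).trans ?_
    rw [← mul_add]
    refine mul_le_mul_of_nonneg_left ?_ hZ
    rw [hE]
    nlinarith
  have hlam2 : 1 ≤ 2 * L * lam := by
    have : (n : ℝ) ≤ 2 * L * lam * n := by
      calc (n : ℝ) ≤ 2 * L * D := h1
        _ = 2 * L * lam * (n - 1) := by rw [hDl]; ring
        _ ≤ _ := by gcongr; linarith
    nlinarith
  have h4 : |S - Z * P| * ((n : ℝ) ^ 2 / (8 * L)) ≤ Z * (r * E) :=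
    (mul_le_mul_of_nonneg_left hK (abs_nonneg _)).trans hSK
  have h5 : |S - Z * P| ≤ Z * (r * E) * (8 * L) / (n : ℝ) ^ 2 := by
    rw [le_div_iff₀ (by positivity)]
    rw [mul_div_assoc', div_le_iff₀ (by positivity)] at h4
    exact h4
  refine h5.trans ?_
  have h6 : (r : ℝ) * (8 * L) ≤ lam * (r - 1) * (32 * L ^ 2) :=
    calc (r : ℝ) * (8 * L) ≤ 2 * (r - 1) * (8 * L) :=
          mul_le_mul_of_nonneg_right (by linarith) (by linarith)
      _ = 16 * L * (r - 1) * 1 := by ring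
      _ ≤ 16 * L * (r - 1) * (2 * L * lam) := mul_le_mul_of_nonneg_left hlam2
          (mul_nonneg (by linarith) (by linarith))
      _ = _ := by ring
  have hst : stepErr n = 32 * L ^ 2 * E / (n : ℝ) ^ 2 := rfl
  rw [hst]
  calc Z * (r * E) * (8 * L) / (n : ℝ) ^ 2 = Z * E * (r * (8 * L)) / (n : ℝ) ^ 2 := by ring
    _ ≤ Z * E * (lam * (r - 1) * (32 * L ^ 2)) / (n : ℝ) ^ 2 :=
        div_le_div_of_nonneg_right (mul_le_mul_of_nonneg_left h6 (mul_nonneg hZ hE0)) (by positivity)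
    _ = _ := by field_simp

end Estimate

section Conclusion

lemma card_degSet_pos {n D : ℕ} (hD : D < n) (heven : Even (D * n)) :
    0 < #(degSet fun _ : Fin n => (D : ℤ)) := by
  obtain ⟨E, hE⟩ := heven
  have hE' : n * D = 2 * E := by rw [mul_comm, hE, two_mul]
  have hEp : E ≤ #(pairs n) := by
    have h1 := card_pairs n
    have h2 : (n : ℝ) * D = 2 * E := by exact_mod_cast hE'
    have h3 : (D : ℝ) + 1 ≤ n := by exact_mod_cast hD
    have h4 : (n : ℝ) * D ≤ n * (n - 1) := by gcongr; linarith
    have h5 : (E : ℝ) ≤ #(pairs n) := by linarith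
    exact_mod_cast h5
  have h := card_filter_sum_ind_le (V := Fin n) D
  rw [Fintype.card_fin, card_filter_sum_ind_eq hE'] at h
  exact Nat.pos_of_mul_pos_left ((Nat.choose_pos hEp).trans_le h)

/-- The expected number of perfect matchings, with an explicit error. -/
lemma pmPairs_div_regCount {n m D : ℕ} (hnm : n = 2 * m) (hn : 14 ≤ n) (hlog : 1 ≤ Real.log n)
    (hD : D < n) (heven : Even (D * n)) (hLn : 8 * Real.log n ≤ n)
    (h1 : (n : ℝ) ≤ 2 * Real.log n * D) (h2 : (n : ℝ) ≤ 2 * Real.log n * (n - 1 - D))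
    (hη : stepErr n ≤ 1) :
    ∃ err, |err| ≤ 3 * stepErr n * Real.log n + 17 * Real.log n ^ 2 / m ∧
      (pmPairs n D : ℝ) / regCount n D =
        lamR n D ^ m * n.factorial / (2 ^ m * m.factorial) *
          Real.exp ((1 - lamR n D) / (4 * lamR n D) + err) := by
  have hn1 : (14 : ℝ) ≤ n := by exact_mod_cast hn
  have hnm' : (n : ℝ) = 2 * m := by exact_mod_cast hnm
  have hDn : (D : ℝ) ≤ n - 1 := by
    have : (D : ℝ) + 1 ≤ n := by exact_mod_cast hD
    linarith
  have hlam2 : 1 ≤ 2 * Real.log n * lamR n D := by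
    unfold lamR
    rw [mul_div_assoc', le_div_iff₀ (by linarith)]
    linarith
  have hl0 : 0 < lamR n D := by
    by_contra h
    have : 2 * Real.log n * lamR n D ≤ 0 :=
      mul_nonpos_of_nonneg_of_nonpos (by linarith) (by linarith)
    linarith
  have hl1 : lamR n D ≤ 1 := by unfold lamR; exact (div_le_one (by linarith)).2 hDn
  have hη0 : 0 ≤ stepErr n := by
    have := one_le_kappa n
    unfold stepErr
    positivity
  have hN := card_degSet_pos hD heven
  have huniv := card_configs_univ (V := Fin n) D
  rw [Fintype.card_fin] at huniv
  obtain ⟨err, herr, h⟩ := ratio_asymptotics (m := m)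
    (z := fun k => (#(configs (Fin n) (D : ℝ) (n - 2 * k)) : ℝ))
    (s := fun k => ∑ p ∈ configs (Fin n) (D : ℝ) (n - 2 * k), edgesIn p.2 (fixedPts p.1))
    (lam := lamR n D) (η := stepErr n) (ℓ := Real.log n) (by omega) hl0 hl1
    (by rw [← hnm']; nlinarith) hlog
    (Real.log_le_log (by exact_mod_cast (by omega : 0 < m)) (by exact_mod_cast (by omega : m ≤ n)))
    hlam2 hη0 hη
    (by rw [mul_zero, Nat.sub_zero, huniv]; exact_mod_cast hN) (by
      intro k hk
      have h3 := card_configs_mul (V := Fin n) (D : ℝ) (n - 2 * (k + 1))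
      rw [Fintype.card_fin, show n - 2 * (k + 1) + 2 = n - 2 * k by omega,
        Nat.cast_sub (by omega)] at h3
      rw [← h3]
      push_cast
      ring) (by
      intro k hk hz
      rw [mul_zero, Nat.sub_zero, huniv, ← hnm'] at hz
      have h3 : (n : ℝ) ^ (2 * k) ≤ (n : ℝ) ^ n :=
        pow_le_pow_right₀ (by linarith) (by omega)
      have h4 := abs_sum_edgesIn_sub_le (r := n - 2 * k) hn hlog hD (by omega) (by omega) heven
        hLn h1 h2 (hz.trans (mul_le_mul_of_nonneg_right h3 (by positivity)))
      have h5 : ((n - 2 * k : ℕ) : ℝ) = 2 * (m - k) := by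
        rw [Nat.cast_sub (by omega), hnm']
        push_cast
        ring
      have h6 : (2 * (m - k) * (2 * (m - k) - 1) * (lamR n D + (n - 2 * (m - k)) *
          (1 - lamR n D) / (n : ℝ) ^ 2) : ℝ) =
          lamR n D * (2 * (m - k)) * (2 * (m - k) - 1) * (1 + edgeCorr m (lamR n D) k) := by
        unfold edgeCorr
        rw [hnm']
        have : (m : ℝ) ≠ 0 := by exact_mod_cast (by omega : m ≠ 0)
        field_simp
        ring
      rw [h5] at h4
      change |_ - _ * (2 * (m - k) * (2 * (m - k) - 1) * (lamR n D + (n - 2 * (m - k)) *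
          (1 - lamR n D) / (n : ℝ) ^ 2))| ≤ _ * (lamR n D * _ * _) * _ at h4
      rw [h6, ← mul_assoc] at h4
      exact h4)
  refine ⟨err, herr, ?_⟩
  rw [pmPairs_eq, regCount_eq]
  simp only [mul_zero, Nat.sub_zero, ← hnm, Nat.sub_self] at h
  exact h

lemma stepErr_le {n v w : ℝ} (hn : 1 ≤ n) (hv : v ^ 2 = n) (hv1 : 1 ≤ v) (hw : 1 ≤ w) {L : ℝ}
    (hL0 : 0 ≤ L) (hL : L ≤ w ^ 2) :
    3 * (32 * L ^ 2 * (20 * (√(160 * n * L) + 1) ^ 3 + 1 + 40 * n) / n ^ 2) * L +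
      17 * L ^ 2 / (n / 2) ≤ 6000000 * (w ^ 9 / v) := by
  have hv0 : 0 < v := by linarith
  have hvw : 1 ≤ v * w := one_le_mul_of_one_le_of_one_le hv1 hw
  have hκ : √(160 * n * L) + 1 ≤ 14 * (v * w) := by
    have : √(160 * n * L) ≤ 13 * (v * w) := by
      rw [Real.sqrt_le_left (by positivity), ← hv]
      nlinarith [mul_le_mul_of_nonneg_left hL (sq_nonneg v), mul_nonneg (sq_nonneg v) (sq_nonneg w)]
    linarith
  have hE : 20 * (√(160 * n * L) + 1) ^ 3 + 1 + 40 * n ≤ 54921 * (v * w) ^ 3 := by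
    have h1 : (√(160 * n * L) + 1) ^ 3 ≤ (14 * (v * w)) ^ 3 := by gcongr
    have h2 : 1 ≤ (v * w) ^ 3 := one_le_pow₀ hvw
    have h3 : n ≤ (v * w) ^ 3 := by
      calc n = v ^ 2 * 1 := by rw [hv, mul_one]
        _ ≤ v ^ 2 * (v * w ^ 3) := by
          gcongr
          exact one_le_mul_of_one_le_of_one_le hv1 (one_le_pow₀ hw)
        _ = _ := by ring
    nlinarith
  have h1 : 3 * (32 * L ^ 2 * (20 * (√(160 * n * L) + 1) ^ 3 + 1 + 40 * n) / n ^ 2) * L ≤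
      3 * (32 * (w ^ 2) ^ 2 * (54921 * (v * w) ^ 3) / n ^ 2) * w ^ 2 := by gcongr
  have h2 : 17 * L ^ 2 / (n / 2) ≤ 34 * (w ^ 9 / v) := by
    calc 17 * L ^ 2 / (n / 2) ≤ 17 * (w ^ 2) ^ 2 / (n / 2) := by gcongr
      _ = 34 * (w ^ 4 / (v * v)) := by rw [← hv]; field_simp; ring
      _ ≤ 34 * (w ^ 9 / (v * 1)) := by gcongr; norm_num
      _ = _ := by rw [mul_one]
  have h3 : 3 * (32 * (w ^ 2) ^ 2 * (54921 * (v * w) ^ 3) / n ^ 2) * w ^ 2 =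
      5272416 * (w ^ 9 / v) := by
    rw [← hv]; field_simp; ring
  have h4 : 0 ≤ w ^ 9 / v := by positivity
  linarith

lemma eventually_stepErr_le {b : ℝ} (hb : b < 1 / 2) :
    ∀ᶠ n : ℕ in atTop, 3 * stepErr n * Real.log n + 17 * Real.log n ^ 2 / ((n : ℝ) / 2) ≤
      6000000 * (n : ℝ) ^ (-b) := by
  have hε : 0 < 2 * ((1 / 2 - b) / 9) := by linarith
  have h1 := (isLittleO_log_rpow_atTop hε).bound one_pos
  filter_upwards [tendsto_natCast_atTop_atTop.eventually h1, eventually_ge_atTop 1] with n hn hn1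
  have hn1' : (1 : ℝ) ≤ n := by exact_mod_cast hn1
  have hL0 := Real.log_nonneg hn1'
  rw [one_mul, Real.norm_of_nonneg hL0, Real.norm_of_nonneg (by positivity)] at hn
  have key := stepErr_le (n := n) (v := (n : ℝ) ^ (1 / 2 : ℝ)) (w := (n : ℝ) ^ ((1 / 2 - b) / 9))
    hn1' (by rw [← Real.rpow_natCast, ← Real.rpow_mul (by positivity)]; norm_num)
    (Real.one_le_rpow hn1' (by norm_num)) (Real.one_le_rpow hn1' (by linarith)) hL0
    (hn.trans (le_of_eq (by
      rw [← Real.rpow_natCast, ← Real.rpow_mul (by positivity)]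
      push_cast
      ring_nf)))
  refine key.trans (le_of_eq ?_)
  rw [← Real.rpow_natCast, ← Real.rpow_mul (by positivity), ← Real.rpow_sub (by linarith)]
  push_cast
  ring_nf

end Conclusion

theorem stmt12 (a b : ℝ) (ha : 0 < a) (hb : 0 < b) (hab : a + b < 1/2)
    (D : ℕ → ℕ)
    (heven : ∀ n, Even (D n * n))
    (hmin : ∀ᶠ n : ℕ in atTop,
      (n : ℝ) / (3 * a * Real.log n) ≤ min (D n : ℝ) ((n : ℝ) - (D n : ℝ) - 1)) :
    ∃ C : ℝ, ∀ᶠ n : ℕ in atTop, Even n → ∃ err : ℝ,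
      |err| ≤ C * (n : ℝ) ^ (-b) ∧
      (pmPairs n (D n) : ℝ) / (regCount n (D n) : ℝ)
        = lamR n (D n) ^ (n / 2) * (n.factorial : ℝ)
            / (2 ^ (n / 2) * ((n / 2).factorial : ℝ))
          * Real.exp ((1 - lamR n (D n)) / (4 * lamR n (D n)) + err) := by
  have hb2 : b < 1 / 2 := by linarith
  have hlog : ∀ᶠ n : ℕ in atTop, 1 ≤ Real.log n :=
    (Real.tendsto_log_atTop.comp tendsto_natCast_atTop_atTop).eventually_ge_atTop 1
  have hLn : ∀ᶠ n : ℕ in atTop, 8 * Real.log n ≤ n := by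
    have h1 := Real.isLittleO_log_id_atTop.bound (by norm_num : (0 : ℝ) < 1 / 8)
    filter_upwards [tendsto_natCast_atTop_atTop.eventually h1, hlog] with n h2 h3
    rw [Real.norm_of_nonneg (by linarith), id, Real.norm_of_nonneg (by positivity)] at h2
    linarith
  have hsmall : ∀ᶠ n : ℕ in atTop, 6000000 * (n : ℝ) ^ (-b) ≤ 1 := by
    have h1 := ((tendsto_rpow_neg_atTop hb).comp tendsto_natCast_atTop_atTop).const_mul
      (6000000 : ℝ)
    rw [mul_zero] at h1
    exact h1.eventually_le_const one_pos
  refine ⟨6000000, ?_⟩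
  filter_upwards [hmin, hlog, hLn, hsmall, eventually_stepErr_le hb2, eventually_ge_atTop 14]
    with n hmin hlog hLn hsmall herr hn hn2
  obtain ⟨m, hm⟩ := hn2
  have hnm : n = 2 * m := by omega
  have hn1 : (14 : ℝ) ≤ n := by exact_mod_cast hn
  have hη0 : 0 ≤ stepErr n := by
    have := one_le_kappa n
    unfold stepErr
    positivity
  have hη : stepErr n ≤ 1 := by
    have : 0 ≤ 17 * Real.log n ^ 2 / ((n : ℝ) / 2) := by positivity
    nlinarith
  have hlow : ∀ x : ℝ, (n : ℝ) / (3 * a * Real.log n) ≤ x → (n : ℝ) ≤ 2 * Real.log n * x := by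
    intro x hx
    rw [div_le_iff₀ (by positivity)] at hx
    have hx0 : 0 < x := by
      by_contra h
      have : x * (3 * a * Real.log n) ≤ 0 :=
        mul_nonpos_of_nonpos_of_nonneg (by linarith) (by positivity)
      linarith
    calc (n : ℝ) ≤ x * (3 * a * Real.log n) := hx
      _ ≤ x * (2 * Real.log n) := by gcongr; linarith
      _ = _ := by ring
  have h1 := hlow _ (hmin.trans (min_le_left _ _))
  have h2 := hlow _ (hmin.trans (min_le_right _ _))
  rw [show (n : ℝ) - D n - 1 = n - 1 - D n by ring] at h2
  have hD : D n < n := by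
    have : (D n : ℝ) < n := by
      by_contra h
      have : 2 * Real.log n * ((n : ℝ) - 1 - D n) ≤ 0 :=
        mul_nonpos_of_nonneg_of_nonpos (by linarith) (by linarith)
      linarith
    exact_mod_cast this
  obtain ⟨err, he, h⟩ := pmPairs_div_regCount hnm hn hlog hD (heven n) hLn h1 h2 hη
  have hm2 : (n : ℝ) / 2 = m := by rw [hnm]; push_cast; ring
  refine ⟨err, he.trans ?_, ?_⟩
  · rw [← hm2]; exact herr
  · rw [show n / 2 = m by omega]; exact h
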